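/- arXiv:2209.09514 — 3 statements merged into one kernel-verified Lean document; each statement's English description precedes it below -/
import Mathlib

section
/- The non-abelian tensor square H(1, 0) ⊗ H(1, 0) is isomorphic to the abelian Lie superalgebra A(6 | 0), and the non-abelian tensor square H(0, 1) ⊗ H(0, 1) is isomorphic to the abelian Lie superalgebra A(1 | 0). -/
open Module Function TensorProduct

universe u v w x y z

/-- The sign `(-1)^(ab)` for degrees `a b : ZMod 2`, as an element of the field `F`. -/
def sgn (F : Type u) [Field F] (a b : ZMod 2) : F :=
  if a = 1 ∧ b = 1 then -1 else 1

/-- A supermodule (ℤ/2-graded vector space) over `F`. -/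
class SuperModule (F : Type u) (V : Type v) [Field F] [AddCommGroup V] [Module F V] where
  grade : ZMod 2 → Submodule F V
  isCompl_grade : IsCompl (grade 0) (grade 1)

/-- The graded piece of degree `a`. -/
abbrev gr (F : Type u) (V : Type v) [Field F] [AddCommGroup V] [Module F V]
    [s : SuperModule F V] (a : ZMod 2) : Submodule F V := s.grade a

/-- A Lie superalgebra structure on a supermodule. -/
class LieSuperAlgebra (F : Type u) (L : Type v) [Field F] [AddCommGroup L] [Module F L]
    [SuperModule F L] where
  bracket : L →ₗ[F] L →ₗ[F] L
  bracket_grade : ∀ (a b : ZMod 2) (x y : L), x ∈ gr F L a → y ∈ gr F L b →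
    bracket x y ∈ gr F L (a + b)
  skew : ∀ (a b : ZMod 2) (x y : L), x ∈ gr F L a → y ∈ gr F L b →
    bracket x y = -(sgn F a b) • bracket y x
  jacobi : ∀ (a b c : ZMod 2) (x y zz : L), x ∈ gr F L a → y ∈ gr F L b → zz ∈ gr F L c →
    sgn F a c • bracket x (bracket y zz) + sgn F b a • bracket y (bracket zz x)
      + sgn F c b • bracket zz (bracket x y) = 0

/-- The bracket of a Lie superalgebra. -/
abbrev br (F : Type u) (L : Type v) [Field F] [AddCommGroup L] [Module F L] [SuperModule F L]
    [s : LieSuperAlgebra F L] : L →ₗ[F] L →ₗ[F] L := s.bracket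

/-- A graded submodule. -/
def IsGradedSub (F : Type u) {V : Type v} [Field F] [AddCommGroup V] [Module F V]
    [SuperModule F V] (N : Submodule F V) : Prop :=
  N ≤ (N ⊓ gr F V 0) ⊔ (N ⊓ gr F V 1)

section LSADefs

variable (F : Type u) [Field F]
variable (L : Type v) [AddCommGroup L] [Module F L] [SuperModule F L] [LieSuperAlgebra F L]

/-- The derived subalgebra `L² = [L, L]`. -/
def derivedSub : Submodule F L := Submodule.span F {t | ∃ x y : L, br F L x y = t}

/-- The center `Z(L)`. -/
def centerSub : Submodule F L := ⨅ x : L, LinearMap.ker ((br F L).flip x)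

/-- The span of brackets `[A, B]` of two submodules. -/
def bracketSub (A B : Submodule F L) : Submodule F L :=
  Submodule.span F {t | ∃ x ∈ A, ∃ y ∈ B, br F L x y = t}

/-- Abelian Lie superalgebra. -/
def IsAbelianLSA : Prop := ∀ x y : L, br F L x y = 0

/-- The lower central series. -/
def lcs : ℕ → Submodule F L
  | 0 => ⊤
  | n + 1 => Submodule.span F {t | ∃ x : L, ∃ y ∈ lcs n, br F L x y = t}

/-- Nilpotent Lie superalgebra. -/
def IsNilpotentLSA : Prop := ∃ n : ℕ, lcs F L n = ⊥

end LSADefs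

/-- Homomorphism of Lie superalgebras: an even linear map preserving grading and bracket. -/
structure LieSuperHom (F : Type u) (L : Type v) (M : Type w) [Field F]
    [AddCommGroup L] [Module F L] [SuperModule F L] [LieSuperAlgebra F L]
    [AddCommGroup M] [Module F M] [SuperModule F M] [LieSuperAlgebra F M]
    extends L →ₗ[F] M where
  map_grade : ∀ (a : ZMod 2) (x : L), x ∈ gr F L a → toLinearMap x ∈ gr F M a
  map_bracket : ∀ x y : L, toLinearMap (br F L x y) = br F M (toLinearMap x) (toLinearMap y)

/-- Isomorphism of Lie superalgebras. -/
def LSAIsomorphic (F : Type u) (L : Type v) (M : Type w) [Field F]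
    [AddCommGroup L] [Module F L] [SuperModule F L] [LieSuperAlgebra F L]
    [AddCommGroup M] [Module F M] [SuperModule F M] [LieSuperAlgebra F M] : Prop :=
  ∃ f : LieSuperHom F L M, Function.Bijective f.toLinearMap

/-- `Q` is (a realization of) the quotient `L / L²`, i.e. the abelianization of `L`. -/
def IsQuotientByDerived (F : Type u) (L : Type v) (Q : Type w) [Field F]
    [AddCommGroup L] [Module F L] [SuperModule F L] [LieSuperAlgebra F L]
    [AddCommGroup Q] [Module F Q] [SuperModule F Q] [LieSuperAlgebra F Q] : Prop :=
  ∃ f : LieSuperHom F L Q, Function.Surjective f.toLinearMap ∧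
    LinearMap.ker f.toLinearMap = derivedSub F L

/-- An action of the Lie superalgebra `P` on the Lie superalgebra `M`. -/
structure LieSuperAction (F : Type u) (P : Type v) (M : Type w) [Field F]
    [AddCommGroup P] [Module F P] [SuperModule F P] [LieSuperAlgebra F P]
    [AddCommGroup M] [Module F M] [SuperModule F M] [LieSuperAlgebra F M] where
  act : P →ₗ[F] M →ₗ[F] M
  act_grade : ∀ (a b : ZMod 2) (p : P) (m : M), p ∈ gr F P a → m ∈ gr F M b →
    act p m ∈ gr F M (a + b)
  act_bracket : ∀ (a b : ZMod 2) (p p' : P) (m : M), p ∈ gr F P a → p' ∈ gr F P b →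
    act (br F P p p') m = act p (act p' m) - sgn F a b • act p' (act p m)
  act_lie : ∀ (a b : ZMod 2) (p : P) (m m' : M), p ∈ gr F P a → m ∈ gr F M b →
    act p (br F M m m') = br F M (act p m) m' + sgn F a b • br F M m (act p m')

/-- A trivial action. -/
def LieSuperAction.IsTrivial {F : Type u} {P : Type v} {M : Type w} [Field F]
    [AddCommGroup P] [Module F P] [SuperModule F P] [LieSuperAlgebra F P]
    [AddCommGroup M] [Module F M] [SuperModule F M] [LieSuperAlgebra F M]
    (α : LieSuperAction F P M) : Prop := ∀ (p : P) (m : M), α.act p m = 0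

/-- The trivial action of `P` on `M`. -/
def trivialAction (F : Type u) (P : Type v) (M : Type w) [Field F]
    [AddCommGroup P] [Module F P] [SuperModule F P] [LieSuperAlgebra F P]
    [AddCommGroup M] [Module F M] [SuperModule F M] [LieSuperAlgebra F M] :
    LieSuperAction F P M where
  act := 0
  act_grade := by
    intro a b p m _ _
    simp only [LinearMap.zero_apply]
    exact (gr F M (a + b)).zero_mem
  act_bracket := by intro a b p p' m _ _; simp
  act_lie := by intro a b p m m' _ _; simp

/-- A Lie superpairing on `M × N` (relative to mutual actions) with values in the
Lie superalgebra `T`; these are exactly the defining relations of the non-abelian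
tensor product `M ⊗ N`. -/
structure SuperPairing (F : Type u) (M : Type v) (N : Type w) (T : Type x) [Field F]
    [AddCommGroup M] [Module F M] [SuperModule F M] [LieSuperAlgebra F M]
    [AddCommGroup N] [Module F N] [SuperModule F N] [LieSuperAlgebra F N]
    [AddCommGroup T] [Module F T] [SuperModule F T] [LieSuperAlgebra F T]
    (α : LieSuperAction F M N) (β : LieSuperAction F N M) where
  pair : M →ₗ[F] N →ₗ[F] T
  pair_grade : ∀ (a b : ZMod 2) (m : M) (n : N), m ∈ gr F M a → n ∈ gr F N b →
    pair m n ∈ gr F T (a + b)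
  rel1 : ∀ (a b : ZMod 2) (m m' : M) (n : N), m ∈ gr F M a → m' ∈ gr F M b →
    pair (br F M m m') n = pair m (α.act m' n) - sgn F a b • pair m' (α.act m n)
  rel2 : ∀ (a b c : ZMod 2) (m : M) (n n' : N), m ∈ gr F M a → n ∈ gr F N b → n' ∈ gr F N c →
    pair m (br F N n n') = sgn F c (a + b) • pair (β.act n' m) n - sgn F a b • pair (β.act n m) n'
  rel3 : ∀ (a b : ZMod 2) (m : M) (n : N) (m' : M) (n' : N), m ∈ gr F M a → n ∈ gr F N b →
    br F T (pair m n) (pair m' n') = - sgn F a b • pair (β.act n m) (α.act m' n')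

/-- `T`, together with the pairing `p`, is (a realization of) the non-abelian tensor
product `M ⊗ N`: it satisfies the universal property among Lie superpairings. -/
def IsTensorProductLSA (F : Type u) (M : Type v) (N : Type w) (T : Type x) [Field F]
    [AddCommGroup M] [Module F M] [SuperModule F M] [LieSuperAlgebra F M]
    [AddCommGroup N] [Module F N] [SuperModule F N] [LieSuperAlgebra F N]
    [AddCommGroup T] [Module F T] [SuperModule F T] [LieSuperAlgebra F T]
    (α : LieSuperAction F M N) (β : LieSuperAction F N M)
    (p : SuperPairing F M N T α β) : Prop :=
  ∀ (T' : Type (max u v w x)) [AddCommGroup T'] [Module F T'] [SuperModule F T']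
    [LieSuperAlgebra F T'] (q : SuperPairing F M N T' α β),
    ∃! h : LieSuperHom F T T', ∀ (m : M) (n : N), h.toLinearMap (p.pair m n) = q.pair m n

/-- A Lie superpairing for the tensor square `L ⊗ L` (with adjoint actions):
the defining relations of the non-abelian tensor square. -/
structure TensorSqPairing (F : Type u) (L : Type v) (T : Type w) [Field F]
    [AddCommGroup L] [Module F L] [SuperModule F L] [LieSuperAlgebra F L]
    [AddCommGroup T] [Module F T] [SuperModule F T] [LieSuperAlgebra F T] where
  pair : L →ₗ[F] L →ₗ[F] T
  pair_grade : ∀ (a b : ZMod 2) (x y : L), x ∈ gr F L a → y ∈ gr F L b →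
    pair x y ∈ gr F T (a + b)
  rel1 : ∀ (a b : ZMod 2) (x x' y : L), x ∈ gr F L a → x' ∈ gr F L b →
    pair (br F L x x') y = pair x (br F L x' y) - sgn F a b • pair x' (br F L x y)
  rel2 : ∀ (a b c : ZMod 2) (x y y' : L), x ∈ gr F L a → y ∈ gr F L b → y' ∈ gr F L c →
    pair x (br F L y y') = sgn F c (a + b) • pair (br F L y' x) y
      - sgn F a b • pair (br F L y x) y'
  rel3 : ∀ (a b : ZMod 2) (x y x' y' : L), x ∈ gr F L a → y ∈ gr F L b →
    br F T (pair x y) (pair x' y') = - sgn F a b • pair (br F L y x) (br F L x' y')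

/-- `T`, together with the pairing `p`, is (a realization of) the non-abelian tensor
square `L ⊗ L`. -/
def IsTensorSquare (F : Type u) (L : Type v) (T : Type w) [Field F]
    [AddCommGroup L] [Module F L] [SuperModule F L] [LieSuperAlgebra F L]
    [AddCommGroup T] [Module F T] [SuperModule F T] [LieSuperAlgebra F T]
    (p : TensorSqPairing F L T) : Prop :=
  ∀ (T' : Type (max u v w)) [AddCommGroup T'] [Module F T'] [SuperModule F T']
    [LieSuperAlgebra F T'] (q : TensorSqPairing F L T'),
    ∃! h : LieSuperHom F T T', ∀ x y : L, h.toLinearMap (p.pair x y) = q.pair x y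

/-- The submodule `L □ L` of a realization `T` of `L ⊗ L`, generated by the elements
`x ⊗ x' + (-1)^{|x||x'|} (x' ⊗ x)` (homogeneous `x, x'`) and `x₀ ⊗ x₀` (`x₀` even). -/
def squareBox (F : Type u) (L : Type v) (T : Type w) [Field F]
    [AddCommGroup L] [Module F L] [SuperModule F L] [LieSuperAlgebra F L]
    [AddCommGroup T] [Module F T] [SuperModule F T] [LieSuperAlgebra F T]
    (p : TensorSqPairing F L T) : Submodule F T :=
  Submodule.span F
    ({t | ∃ (a b : ZMod 2) (x y : L), x ∈ gr F L a ∧ y ∈ gr F L b ∧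
        t = p.pair x y + sgn F a b • p.pair y x} ∪
      {t | ∃ x ∈ gr F L 0, t = p.pair x x})

/-- Data of a "universal quadratic functor" target: maps satisfying the defining
relations of `Γ(V)`. -/
structure GammaData (F : Type u) (V : Type v) (W : Type w) [Field F]
    [AddCommGroup V] [Module F V] [SuperModule F V] [AddCommGroup W] [Module F W] where
  gam : V → W
  bil : V →ₗ[F] V →ₗ[F] W
  gam_smul : ∀ (c : F) (v : V), v ∈ gr F V 0 → gam (c • v) = (c * c) • gam v
  gam_add : ∀ v w' : V, v ∈ gr F V 0 → w' ∈ gr F V 0 →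
    gam (v + w') - gam v - gam w' = bil v w'
  bil_symm : ∀ (a b : ZMod 2) (v w' : V), v ∈ gr F V a → w' ∈ gr F V b →
    bil v w' = sgn F a b • bil w' v
  bil_alt : ∀ v : V, v ∈ gr F V 1 → bil v v = 0

/-- `W`, with data `d`, is (a realization of) the universal quadratic functor `Γ(V)`. -/
def IsGamma (F : Type u) (V : Type v) (W : Type w) [Field F]
    [AddCommGroup V] [Module F V] [SuperModule F V] [AddCommGroup W] [Module F W]
    (d : GammaData F V W) : Prop :=
  ∀ (W' : Type (max u v w)) [AddCommGroup W'] [Module F W'] (d' : GammaData F V W'),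
    ∃! h : W →ₗ[F] W',
      (∀ v ∈ gr F V 0, h (d.gam v) = d'.gam v) ∧ (∀ v w' : V, h (d.bil v w') = d'.bil v w')

/-- `Fr` is a free Lie superalgebra on the graded set `(X, deg)` with inclusion `ι`. -/
def IsFreeLSA (F : Type u) (X : Type v) (deg : X → ZMod 2) (Fr : Type w) [Field F]
    [AddCommGroup Fr] [Module F Fr] [SuperModule F Fr] [LieSuperAlgebra F Fr]
    (ι : X → Fr) : Prop :=
  (∀ x : X, ι x ∈ gr F Fr (deg x)) ∧
  ∀ (K : Type (max u v w)) [AddCommGroup K] [Module F K] [SuperModule F K]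
    [LieSuperAlgebra F K] (f : X → K), (∀ x : X, f x ∈ gr F K (deg x)) →
    ∃! h : LieSuperHom F Fr K, ∀ x : X, h.toLinearMap (ι x) = f x

/-- Dimension of the degree-`a` part of the Schur multiplier `(R ∩ [Fr,Fr])/[Fr,R]`
attached to a free presentation with kernel `R`. -/
noncomputable def schurDim (F : Type u) (Fr : Type v) [Field F] [AddCommGroup Fr]
    [Module F Fr] [SuperModule F Fr] [LieSuperAlgebra F Fr]
    (R : Submodule F Fr) (a : ZMod 2) : ℕ :=
  finrank F ((R ⊓ derivedSub F Fr ⊓ gr F Fr a).map (bracketSub F Fr ⊤ R).mkQ)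

/-- `L` is (isomorphic to) the Heisenberg Lie superalgebra `H(m, n)` with even center:
it admits a homogeneous basis `x₁,…,x_{2m}, y₁,…,y_n, z` with the defining brackets. -/
def IsHmn (F : Type u) (m n : ℕ) (L : Type v) [Field F]
    [AddCommGroup L] [Module F L] [SuperModule F L] [LieSuperAlgebra F L] : Prop :=
  ∃ (xv : Fin (2 * m) → L) (yv : Fin n → L) (zv : L)
    (B : Basis ((Fin (2 * m)) ⊕ (Fin n) ⊕ Unit) F L),
    (∀ i, B (Sum.inl i) = xv i) ∧ (∀ j, B (Sum.inr (Sum.inl j)) = yv j) ∧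
    B (Sum.inr (Sum.inr ())) = zv ∧
    (∀ i, xv i ∈ gr F L 0) ∧ (∀ j, yv j ∈ gr F L 1) ∧ zv ∈ gr F L 0 ∧
    (∀ i j : Fin (2 * m), br F L (xv i) (xv j) =
      if (j : ℕ) = (i : ℕ) + m then zv else if (i : ℕ) = (j : ℕ) + m then -zv else 0) ∧
    (∀ (i : Fin (2 * m)) (j : Fin n), br F L (xv i) (yv j) = 0) ∧
    (∀ (j : Fin n) (i : Fin (2 * m)), br F L (yv j) (xv i) = 0) ∧
    (∀ j k : Fin n, br F L (yv j) (yv k) = if j = k then zv else 0) ∧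
    (∀ i, br F L (xv i) zv = 0) ∧ (∀ i, br F L zv (xv i) = 0) ∧
    (∀ j, br F L (yv j) zv = 0) ∧ (∀ j, br F L zv (yv j) = 0) ∧
    br F L zv zv = 0

/-- `L` is (isomorphic to) the Heisenberg Lie superalgebra `H_m` with odd center. -/
def IsHmOdd (F : Type u) (m : ℕ) (L : Type v) [Field F]
    [AddCommGroup L] [Module F L] [SuperModule F L] [LieSuperAlgebra F L] : Prop :=
  ∃ (xv yv : Fin m → L) (zv : L) (B : Basis ((Fin m) ⊕ (Fin m) ⊕ Unit) F L),
    (∀ i, B (Sum.inl i) = xv i) ∧ (∀ j, B (Sum.inr (Sum.inl j)) = yv j) ∧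
    B (Sum.inr (Sum.inr ())) = zv ∧
    (∀ i, xv i ∈ gr F L 0) ∧ (∀ j, yv j ∈ gr F L 1) ∧ zv ∈ gr F L 1 ∧
    (∀ i j, br F L (xv i) (xv j) = 0) ∧
    (∀ i j, br F L (xv i) (yv j) = if i = j then zv else 0) ∧
    (∀ i j, br F L (yv i) (xv j) = if i = j then -zv else 0) ∧
    (∀ i j, br F L (yv i) (yv j) = 0) ∧
    (∀ i, br F L (xv i) zv = 0) ∧ (∀ i, br F L zv (xv i) = 0) ∧
    (∀ j, br F L (yv j) zv = 0) ∧ (∀ j, br F L zv (yv j) = 0) ∧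
    br F L zv zv = 0

/-- `A` is (isomorphic to) the abelian Lie superalgebra `A(a | b)`. -/
def IsAbelianOfDim (F : Type u) (a b : ℕ) (A : Type v) [Field F]
    [AddCommGroup A] [Module F A] [SuperModule F A] [LieSuperAlgebra F A] : Prop :=
  IsAbelianLSA F A ∧ finrank F (gr F A 0) = a ∧ finrank F (gr F A 1) = b

/-- Heisenberg Lie superalgebra with even center: `Z(L) = L²` is one-dimensional,
spanned by a nonzero even element. -/
def IsHeisenbergEven (F : Type u) (L : Type v) [Field F]
    [AddCommGroup L] [Module F L] [SuperModule F L] [LieSuperAlgebra F L] : Prop :=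
  centerSub F L = derivedSub F L ∧
  ∃ zc : L, zc ≠ 0 ∧ zc ∈ gr F L 0 ∧ centerSub F L = Submodule.span F {zc}

/-- Heisenberg Lie superalgebra with odd center. -/
def IsHeisenbergOdd (F : Type u) (L : Type v) [Field F]
    [AddCommGroup L] [Module F L] [SuperModule F L] [LieSuperAlgebra F L] : Prop :=
  centerSub F L = derivedSub F L ∧
  ∃ zc : L, zc ≠ 0 ∧ zc ∈ gr F L 1 ∧ centerSub F L = Submodule.span F {zc}

/-- `P ≅ L ⊕ M` as Lie superalgebras (internal direct sum of two commuting copies). -/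
def IsDirectSumOf (F : Type u) (P : Type v) (L : Type w) (M : Type x) [Field F]
    [AddCommGroup P] [Module F P] [SuperModule F P] [LieSuperAlgebra F P]
    [AddCommGroup L] [Module F L] [SuperModule F L] [LieSuperAlgebra F L]
    [AddCommGroup M] [Module F M] [SuperModule F M] [LieSuperAlgebra F M] : Prop :=
  ∃ (f : LieSuperHom F L P) (g : LieSuperHom F M P),
    Function.Bijective (fun q : L × M => f.toLinearMap q.1 + g.toLinearMap q.2) ∧
    (∀ (x : L) (y : M), br F P (f.toLinearMap x) (g.toLinearMap y) = 0) ∧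
    (∀ (y : M) (x : L), br F P (g.toLinearMap y) (f.toLinearMap x) = 0)

/-- `S ≅ A ⊕ B ⊕ C ⊕ D` as Lie superalgebras. -/
def IsDirectSumOf4 (F : Type u) (S : Type v) (A : Type w) (B : Type x) (C : Type y)
    (D : Type z) [Field F]
    [AddCommGroup S] [Module F S] [SuperModule F S] [LieSuperAlgebra F S]
    [AddCommGroup A] [Module F A] [SuperModule F A] [LieSuperAlgebra F A]
    [AddCommGroup B] [Module F B] [SuperModule F B] [LieSuperAlgebra F B]
    [AddCommGroup C] [Module F C] [SuperModule F C] [LieSuperAlgebra F C]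
    [AddCommGroup D] [Module F D] [SuperModule F D] [LieSuperAlgebra F D] : Prop :=
  ∃ (f : LieSuperHom F A S) (g : LieSuperHom F B S) (h : LieSuperHom F C S)
    (k : LieSuperHom F D S),
    Function.Bijective (fun q : A × B × C × D =>
      f.toLinearMap q.1 + g.toLinearMap q.2.1 + h.toLinearMap q.2.2.1
        + k.toLinearMap q.2.2.2) ∧
    (∀ u v', br F S (f.toLinearMap u) (g.toLinearMap v') = 0) ∧
    (∀ u v', br F S (f.toLinearMap u) (h.toLinearMap v') = 0) ∧
    (∀ u v', br F S (f.toLinearMap u) (k.toLinearMap v') = 0) ∧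
    (∀ u v', br F S (g.toLinearMap u) (h.toLinearMap v') = 0) ∧
    (∀ u v', br F S (g.toLinearMap u) (k.toLinearMap v') = 0) ∧
    (∀ u v', br F S (h.toLinearMap u) (k.toLinearMap v') = 0)

/-- `L ≅ H(m, n) ⊕ A(a | b)`: an internal decomposition into a Heisenberg part with
even center, spanned by homogeneous elements with the defining brackets, and a central
abelian graded complement of dimension `(a | b)`. -/
def DecompHeisenbergAbelian (F : Type u) (L : Type v) [Field F]
    [AddCommGroup L] [Module F L] [SuperModule F L] [LieSuperAlgebra F L]
    (m n a b : ℕ) : Prop :=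
  ∃ (xv : Fin (2 * m) → L) (yv : Fin n → L) (zv : L) (A : Submodule F L),
    (∀ i, xv i ∈ gr F L 0) ∧ (∀ j, yv j ∈ gr F L 1) ∧ zv ∈ gr F L 0 ∧
    IsGradedSub F A ∧
    finrank F (A ⊓ gr F L 0 : Submodule F L) = a ∧
    finrank F (A ⊓ gr F L 1 : Submodule F L) = b ∧
    (∀ u ∈ A, ∀ v : L, br F L u v = 0 ∧ br F L v u = 0) ∧
    LinearIndependent F (Sum.elim xv (Sum.elim yv (fun _ : Unit => zv))) ∧
    Disjoint (Submodule.span F (Set.range (Sum.elim xv (Sum.elim yv (fun _ : Unit => zv))))) A ∧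
    Submodule.span F (Set.range (Sum.elim xv (Sum.elim yv (fun _ : Unit => zv)))) ⊔ A = ⊤ ∧
    (∀ i j : Fin (2 * m), br F L (xv i) (xv j) =
      if (j : ℕ) = (i : ℕ) + m then zv else if (i : ℕ) = (j : ℕ) + m then -zv else 0) ∧
    (∀ (i : Fin (2 * m)) (j : Fin n), br F L (xv i) (yv j) = 0) ∧
    (∀ (j : Fin n) (i : Fin (2 * m)), br F L (yv j) (xv i) = 0) ∧
    (∀ j k : Fin n, br F L (yv j) (yv k) = if j = k then zv else 0) ∧
    (∀ i, br F L (xv i) zv = 0) ∧ (∀ i, br F L zv (xv i) = 0) ∧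
    (∀ j, br F L (yv j) zv = 0) ∧ (∀ j, br F L zv (yv j) = 0) ∧
    br F L zv zv = 0

/-- The submodule of a realization of `I ⊗ J` (for graded ideals `I, J` of `M`)
generated by `x ⊗ y + (-1)^(|x||y|) y ⊗ x` and `x₀ ⊗ x₀` for `x, y, x₀ ∈ I ∩ J`,
`x₀` even. -/
def pairBox (F : Type u) (I : Type v) (J : Type w) (TIJ : Type x) (M : Type y) [Field F]
    [AddCommGroup I] [Module F I] [SuperModule F I] [LieSuperAlgebra F I]
    [AddCommGroup J] [Module F J] [SuperModule F J] [LieSuperAlgebra F J]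
    [AddCommGroup TIJ] [Module F TIJ] [SuperModule F TIJ] [LieSuperAlgebra F TIJ]
    [AddCommGroup M] [Module F M] [SuperModule F M] [LieSuperAlgebra F M]
    (ι : LieSuperHom F I M) (κ : LieSuperHom F J M)
    (α : LieSuperAction F I J) (β : LieSuperAction F J I)
    (p : SuperPairing F I J TIJ α β) : Submodule F TIJ :=
  Submodule.span F
    ({t | ∃ (a b : ZMod 2) (i i' : I) (j j' : J),
        ι.toLinearMap i = κ.toLinearMap j ∧ ι.toLinearMap i' = κ.toLinearMap j' ∧
        ι.toLinearMap i ∈ gr F M a ∧ ι.toLinearMap i' ∈ gr F M b ∧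
        t = p.pair i j' + sgn F a b • p.pair i' j} ∪
      {t | ∃ (i : I) (j : J), ι.toLinearMap i = κ.toLinearMap j ∧
        ι.toLinearMap i ∈ gr F M 0 ∧ t = p.pair i j})


/-- The purely even abelian superalgebra structure. -/
@[reducible] def evenSuper (F : Type u) (V : Type v) [Field F] [AddCommGroup V] [Module F V] :
    SuperModule F V where
  grade a := if a = 0 then ⊤ else ⊥
  isCompl_grade := by simpa using isCompl_top_bot

@[reducible] def evenLie (F : Type u) (V : Type v) [Field F] [AddCommGroup V] [Module F V] :
    @LieSuperAlgebra F V _ _ _ (evenSuper F V) :=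
  letI := evenSuper F V
  { bracket := 0
    bracket_grade := by intro a b x y _ _; simp
    skew := by intros; simp
    jacobi := by intros; simp }

@[reducible] def upSuper (F : Type u) (V : Type v) [Field F] [AddCommGroup V] [Module F V]
    [SuperModule F V] : SuperModule F (ULift.{w} V) where
  grade a := (gr F V a).comap (ULift.moduleEquiv (R := F) (M := V)).toLinearMap
  isCompl_grade := by
    have h := (SuperModule.isCompl_grade (F := F) (V := V))
    exact (Submodule.orderIsoMapComap (ULift.moduleEquiv (R := F) (M := V))).symm.isCompl h

@[reducible] def upLie (F : Type u) (V : Type v) [Field F] [AddCommGroup V] [Module F V]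
    [SuperModule F V] [LieSuperAlgebra F V] :
    @LieSuperAlgebra F (ULift.{w} V) _ _ _ (upSuper F V) :=
  letI := upSuper.{u, v, w} F V
  { bracket := LinearMap.mk₂ F (fun x y => ULift.up (br F V x.down y.down))
      (by intros; ext; simp) (by intros; ext; simp) (by intros; ext; simp) (by intros; ext; simp)
    bracket_grade := by
      intro a b x y hx hy
      exact LieSuperAlgebra.bracket_grade a b x.down y.down hx hy
    skew := by
      intro a b x y hx hy
      ext
      exact LieSuperAlgebra.skew a b x.down y.down hx hy
    jacobi := by
      intro a b c x y z hx hy hz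
      ext
      exact LieSuperAlgebra.jacobi a b c x.down y.down z.down hx hy hz }

theorem key_lemma (F : Type u) [Field F] (L : Type v) [AddCommGroup L] [Module F L]
    [SuperModule F L] [LieSuperAlgebra F L] (T : Type w) [AddCommGroup T] [Module F T]
    [SuperModule F T] [LieSuperAlgebra F T] (p : TensorSqPairing F L T)
    (hT : IsTensorSquare F L T p) (n : ℕ) (q : L →ₗ[F] L →ₗ[F] (Fin n → F))
    (hqg : ∀ (a b : ZMod 2) (x y : L), x ∈ gr F L a → y ∈ gr F L b → a + b ≠ 0 → q x y = 0)
    (hq1 : ∀ (a b : ZMod 2) (x x' y : L), x ∈ gr F L a → x' ∈ gr F L b →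
      q (br F L x x') y = q x (br F L x' y) - sgn F a b • q x' (br F L x y))
    (hq2 : ∀ (a b c : ZMod 2) (x y y' : L), x ∈ gr F L a → y ∈ gr F L b → y' ∈ gr F L c →
      q x (br F L y y') = sgn F c (a + b) • q (br F L y' x) y
        - sgn F a b • q (br F L y x) y')
    (hq3 : ∀ x y x' y' : L, q (br F L y x) (br F L x' y') = 0)
    (t : Fin n → T) (xs ys : Fin n → L) (hxy : ∀ i, t i = p.pair (xs i) (ys i))
    (hqt : ∀ i, q (xs i) (ys i) = Pi.single i 1)
    (ht0 : ∀ i, t i ∈ gr F T 0) (htb : ∀ i j, br F T (t i) (t j) = 0)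
    (hpq : ∀ x y, p.pair x y = ∑ i, q x y i • t i) : IsAbelianOfDim F n 0 T := by
  classical
  -- the hom to the model
  obtain ⟨h, hh, hho, hhb⟩ : ∃ h : T →ₗ[F] (Fin n → F), (∀ x y, h (p.pair x y) = q x y) ∧
      (∀ s ∈ gr F T 1, h s = 0) ∧ (∀ s s', h (br F T s s') = 0) := by
    letI := evenSuper F (ULift.{max v w} (Fin n → F))
    letI := evenLie F (ULift.{max v w} (Fin n → F))
    let e : ULift.{max v w} (Fin n → F) ≃ₗ[F] (Fin n → F) := ULift.moduleEquiv
    obtain ⟨h, hh, -⟩ := hT (ULift.{max v w} (Fin n → F))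
      { pair := LinearMap.mk₂ F (fun x y => e.symm (q x y))
          (by intros; simp) (by intros; simp) (by intros; simp) (by intros; simp)
        pair_grade := by
          intro a b x y hx hy
          by_cases hab : a + b = 0
          · rw [hab]
            change _ ∈ (if (0 : ZMod 2) = 0 then (⊤ : Submodule F _) else ⊥)
            simp
          · simp [hqg a b x y hx hy hab]
        rel1 := by
          intro a b x x' y hx hx'
          simp [hq1 a b x x' y hx hx']
        rel2 := by
          intro a b c x x' y hx hx' hy
          simp [hq2 a b c x x' y hx hx' hy]
        rel3 := by
          intro a b x y x' y' _ _
          simp only [LinearMap.mk₂_apply, hq3 x y x' y', map_zero, smul_zero]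
          rfl }
    refine ⟨e.toLinearMap ∘ₗ h.toLinearMap, fun x y => ?_, fun s hs => ?_, fun s s' => ?_⟩
    · simp [hh]
    · have h2 : h.toLinearMap s ∈ (if (1 : ZMod 2) = 0 then (⊤ : Submodule F _) else ⊥) :=
        h.map_grade 1 s hs
      simp at h2
      simp [h2]
    · have h2 : h.toLinearMap (br F T s s') = 0 := h.map_bracket s s'
      simp only [LinearMap.comp_apply, h2, map_zero]
  let g : (Fin n → F) →ₗ[F] T := Fintype.linearCombination F t
  have hgap : ∀ v, g v = ∑ i, v i • t i := fun v => Fintype.linearCombination_apply F t v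
  have hg0 : ∀ v, g v ∈ gr F T 0 := fun v => by
    rw [hgap]; exact Submodule.sum_mem _ fun i _ => Submodule.smul_mem _ _ (ht0 i)
  have hgb : ∀ v v', br F T (g v) (g v') = 0 := fun v v' => by
    rw [hgap, hgap]; simp [htb]
  have hbrp : ∀ x y, br F T (p.pair x y) = br F T (g (q x y)) := fun x y => by
    rw [hgap, hpq]
  have hgh : ∀ s, g (h s) = s := by
    letI := upSuper.{u, w, max u v} F T
    letI := upLie.{u, w, max u v} F T
    let e : ULift.{max u v} T ≃ₗ[F] T := ULift.moduleEquiv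
    obtain ⟨k, -, hk⟩ := hT (ULift.{max u v} T)
      { pair := LinearMap.mk₂ F (fun x y => e.symm (p.pair x y))
          (by intros; simp) (by intros; simp) (by intros; simp) (by intros; simp)
        pair_grade := fun a b x y hx hy => p.pair_grade a b x y hx hy
        rel1 := by
          intro a b x x' y hx hx'
          simp [p.rel1 a b x x' y hx hx']
        rel2 := by
          intro a b c x x' y hx hx' hy
          simp [p.rel2 a b c x x' y hx hx' hy]
        rel3 := by
          intro a b x y x' y' hx hy
          ext
          exact p.rel3 a b x y x' y' hx hy }
    have e1 := hk { toLinearMap := e.symm.toLinearMap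
                    map_grade := fun a x hx => hx
                    map_bracket := fun x y => rfl } (fun x y => rfl)
    have hq_p : ∀ x y, g (q x y) = p.pair x y := fun x y => by rw [hgap, hpq]
    have e2 := hk { toLinearMap := e.symm.toLinearMap ∘ₗ g ∘ₗ h
                    map_grade := fun a x hx => by
                      change g (h x) ∈ gr F T a
                      by_cases ha : a = 0
                      · rw [ha]; exact hg0 _
                      · have ha1 : a = 1 := by
                          have hz2 : ∀ a : ZMod 2, a = 0 ∨ a = 1 := by decide
                          exact (hz2 a).resolve_left ha
                        rw [ha1] at hx
                        rw [hho x hx, map_zero]; exact Submodule.zero_mem _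
                    map_bracket := fun x y => by
                      apply ULift.ext
                      change g (h (br F T x y)) = br F T (g (h x)) (g (h y))
                      rw [hhb, hgb, map_zero] }
        (fun x y => by
          apply ULift.ext
          change g (h (p.pair x y)) = p.pair x y
          rw [hh, hq_p])
    intro s
    have e3 := congrArg (fun f => (f.toLinearMap s).down) (e2.trans e1.symm)
    exact e3
  have hhg : ∀ v, h (g v) = v := by
    intro v
    rw [hgap, map_sum]
    simp only [map_smul, hxy, hh, hqt]
    exact (pi_eq_sum_univ' v).symm
  have htop : gr F T 0 = ⊤ := by
    rw [eq_top_iff]; intro s _; rw [← hgh s]; exact hg0 _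
  have hbot : gr F T 1 = ⊥ := by
    rw [eq_bot_iff]; intro s hs
    rw [Submodule.mem_bot, ← hgh s, hho s hs, map_zero]
  refine ⟨fun x y => ?_, ?_, ?_⟩
  · rw [← hgh x, ← hgh y, hgb]
  · rw [htop, finrank_top]
    let e : T ≃ₗ[F] (Fin n → F) := LinearEquiv.ofLinearMap h g (LinearMap.ext hhg) (LinearMap.ext hgh)
    rw [e.finrank_eq]; simp
  · rw [hbot]; simp

theorem six_pair (F : Type u) [Field F] (L : Type v) [AddCommGroup L] [Module F L]
    (e1 e2 e3 : L →ₗ[F] F) : ∃ q : L →ₗ[F] L →ₗ[F] (Fin 6 → F), ∀ x y, q x y =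
      ![e1 x * e1 y, e1 x * e2 y, e2 x * e1 y, e2 x * e2 y,
        e3 x * e1 y - e1 x * e3 y, e3 x * e2 y - e2 x * e3 y] := by
  let m : (L →ₗ[F] F) → (L →ₗ[F] F) → (L →ₗ[F] L →ₗ[F] F) := fun f g =>
    (LinearMap.mul F F).compl₁₂ f g
  refine ⟨LinearMap.mk₂ F (fun x y => fun i => (![m e1 e1, m e1 e2, m e2 e1, m e2 e2,
    m e3 e1 - m e1 e3, m e3 e2 - m e2 e3] i) x y) ?_ ?_ ?_ ?_, ?_⟩
  · intros; ext i; simp only [map_add, LinearMap.add_apply, Pi.add_apply]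
  · intros; ext i; simp only [map_smul, LinearMap.smul_apply, Pi.smul_apply]
  · intros; ext i; simp only [map_add, Pi.add_apply]
  · intros; ext i; simp only [map_smul, Pi.smul_apply]
  · intro x y; ext i; fin_cases i <;> rfl

set_option maxHeartbeats 4000000 in
theorem heis_one (F : Type u) [Field F] (L : Type v) [AddCommGroup L] [Module F L]
    [SuperModule F L] [LieSuperAlgebra F L] (hL : IsHmn F 1 0 L)
    (T : Type w) [AddCommGroup T] [Module F T]
    [SuperModule F T] [LieSuperAlgebra F T] (p : TensorSqPairing F L T)
    (hT : IsTensorSquare F L T p) : IsAbelianOfDim F 6 0 T := by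
  obtain ⟨xv, yv, z, B, hBx, -, hBz, hx0, -, hz0, hxx, -, -, -, hxz, hzx, -, -, hzz⟩ := hL
  obtain ⟨x1, hx1⟩ : ∃ x, x = xv 0 := ⟨_, rfl⟩
  obtain ⟨x2, hx2⟩ : ∃ x, x = xv 1 := ⟨_, rfl⟩
  obtain ⟨e1, he1⟩ : ∃ e, e = B.coord (Sum.inl 0) := ⟨_, rfl⟩
  obtain ⟨e2, he2⟩ : ∃ e, e = B.coord (Sum.inl 1) := ⟨_, rfl⟩
  obtain ⟨e3, he3⟩ : ∃ e, e = B.coord (Sum.inr (Sum.inr ())) := ⟨_, rfl⟩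
  have hexp : ∀ v, v = e1 v • x1 + e2 v • x2 + e3 v • z := by
    intro v
    conv_lhs => rw [← B.sum_repr v]
    rw [Fintype.sum_sum_type, Fintype.sum_sum_type]
    erw [Fin.sum_univ_two]
    rw [he1, he2, he3, hx1, hx2, ← hBx 0, ← hBx 1, ← hBz]
    simp
  have a11 : e1 x1 = 1 := by simp [he1, hx1, ← hBx]
  have a12 : e1 x2 = 0 := by simp [he1, hx2, ← hBx]
  have a13 : e1 z = 0 := by simp [he1, ← hBz]
  have a21 : e2 x1 = 0 := by simp [he2, hx1, ← hBx]
  have a22 : e2 x2 = 1 := by simp [he2, hx2, ← hBx]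
  have a23 : e2 z = 0 := by simp [he2, ← hBz]
  have a31 : e3 x1 = 0 := by simp [he3, hx1, ← hBx]
  have a32 : e3 x2 = 0 := by simp [he3, hx2, ← hBx]
  have a33 : e3 z = 1 := by simp [he3, ← hBz]
  have b11 : br F L x1 x1 = 0 := by rw [hx1, hxx]; simp
  have b12 : br F L x1 x2 = z := by rw [hx1, hx2, hxx]; simp
  have b21 : br F L x2 x1 = -z := by rw [hx1, hx2, hxx]; simp
  have b22 : br F L x2 x2 = 0 := by rw [hx2, hxx]; simp
  have b13 : br F L x1 z = 0 := by rw [hx1, hxz]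
  have b23 : br F L x2 z = 0 := by rw [hx2, hxz]
  have b31 : br F L z x1 = 0 := by rw [hx1, hzx]
  have b32 : br F L z x2 = 0 := by rw [hx2, hzx]
  have g1 : x1 ∈ gr F L 0 := hx1 ▸ hx0 0
  have g2 : x2 ∈ gr F L 0 := hx2 ▸ hx0 1
  clear hx1 hx2 he1 he2 he3 hxx hxz hzx hx0 hBx hBz B xv yv
  have hev : ∀ v, v ∈ gr F L 0 := by
    intro v; rw [hexp v]
    exact Submodule.add_mem _ (Submodule.add_mem _ (Submodule.smul_mem _ _ g1)
      (Submodule.smul_mem _ _ g2)) (Submodule.smul_mem _ _ hz0)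
  have hodd : ∀ v, v ∈ gr F L 1 → v = 0 := by
    intro v hv
    exact (Submodule.disjoint_def.1 (SuperModule.isCompl_grade (F := F) (V := L)).disjoint) v (hev v) hv
  have hbr : ∀ u v, br F L u v = (e1 u * e2 v - e2 u * e1 v) • z := by
    intro u v
    conv_lhs => rw [hexp u, hexp v]
    simp only [map_add, map_smul, LinearMap.add_apply, LinearMap.smul_apply, b11, b12, b21, b22,
      b13, b23, b31, b32, hzz]
    module
  have s0 : sgn F 0 0 = 1 := by simp [sgn]
  have r1 : ∀ x x' y, p.pair (br F L x x') y = p.pair x (br F L x' y) - p.pair x' (br F L x y) := by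
    intro x x' y
    have := p.rel1 0 0 x x' y (hev _) (hev _)
    rwa [s0, one_smul] at this
  have pz1 : p.pair x1 z = - p.pair z x1 := by
    have := r1 x1 x2 x1
    rw [b12, b21, b11] at this
    simp only [map_neg, map_zero, sub_zero] at this
    rw [this, neg_neg]
  have pz2 : p.pair x2 z = - p.pair z x2 := by
    have := r1 x1 x2 x2
    rw [b12, b22] at this
    simp only [map_zero, zero_sub] at this
    rw [this, neg_neg]
  have pzz : p.pair z z = 0 := by
    have := r1 x1 x2 z
    rw [b12, b23, b13] at this
    simpa using this
  have hb : ∀ x y x' y', br F T (p.pair x y) (p.pair x' y') = 0 := by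
    intro x y x' y'
    rw [p.rel3 0 0 x y x' y' (hev _) (hev _), hbr, hbr]
    simp [pzz]
  obtain ⟨q, hq⟩ : ∃ q : L →ₗ[F] L →ₗ[F] (Fin 6 → F), ∀ x y, q x y =
      ![e1 x * e1 y, e1 x * e2 y, e2 x * e1 y, e2 x * e2 y,
        e3 x * e1 y - e1 x * e3 y, e3 x * e2 y - e2 x * e3 y] := six_pair F L e1 e2 e3
  have hz2 : ∀ a : ZMod 2, a = 0 ∨ a = 1 := by decide
  have hq1 : ∀ x x' y : L,
      q (br F L x x') y = q x (br F L x' y) - q x' (br F L x y) := by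
    intro x x' y
    rw [hbr, hbr, hbr, hq, hq, hq]
    ext i; fin_cases i <;> simp [a13, a23, a33] <;> ring
  have hq2 : ∀ x y y' : L, q x (br F L y y') = q (br F L y' x) y - q (br F L y x) y' := by
    intro x x' y
    rw [hbr, hbr, hbr, hq, hq, hq]
    ext i; fin_cases i <;> simp [a13, a23, a33] <;> ring
  let xs : Fin 6 → L := ![x1, x1, x2, x2, z, z]
  let ys : Fin 6 → L := ![x1, x2, x1, x2, x1, x2]
  refine key_lemma F L T p hT 6 q ?_ ?_ ?_ ?_ (fun i => p.pair (xs i) (ys i)) xs ys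
    (fun i => rfl) ?_ ?_ ?_ ?_
  · intro a b x y hx hy hab
    rcases hz2 a with rfl | rfl
    · rcases hz2 b with rfl | rfl
      · exact absurd (by decide) hab
      · rw [hodd y hy, map_zero]
    · rw [hodd x hx, map_zero, LinearMap.zero_apply]
  · intro a b x x' y hx hx'
    rcases hz2 a with rfl | rfl
    · simpa [sgn] using hq1 x x' y
    · rw [hodd x hx]; simp
  · intro a b c x y y' hx hy hy'
    rcases hz2 a with rfl | rfl
    · rcases hz2 b with rfl | rfl
      · simpa [sgn] using hq2 x y y'
      · rw [hodd y hy]; simp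
    · rw [hodd x hx]; simp
  · intro x y x' y'
    rw [hbr, hbr, hq]
    ext i; fin_cases i <;> simp [a13, a23]
  · intro i
    rw [hq]
    fin_cases i <;> ext j <;> fin_cases j <;>
      simp [xs, ys, a11, a12, a13, a21, a22, a23, a31, a32, a33, Pi.single_apply]
  · intro i
    exact p.pair_grade 0 0 _ _ (hev _) (hev _)
  · intro i j; exact hb _ _ _ _
  · intro x y
    rw [Fin.sum_univ_six, hq]
    conv_lhs => rw [hexp x, hexp y]
    simp only [map_add, map_smul, LinearMap.add_apply, LinearMap.smul_apply, pz1, pz2, pzz]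
    simp [xs, ys]
    module

theorem heis_zero (F : Type u) [Field F] (hchar3 : ringChar F ≠ 3)
    (L : Type v) [AddCommGroup L] [Module F L]
    [SuperModule F L] [LieSuperAlgebra F L] (hL : IsHmn F 0 1 L)
    (T : Type w) [AddCommGroup T] [Module F T]
    [SuperModule F T] [LieSuperAlgebra F T] (p : TensorSqPairing F L T)
    (hT : IsTensorSquare F L T p) : IsAbelianOfDim F 1 0 T := by
  obtain ⟨xv, yv, z, B, -, hBy, hBz, -, hy1, hz0, -, -, -, hyy, -, -, hyz, hzy, hzz⟩ := hL
  obtain ⟨y, hy⟩ : ∃ x, x = yv 0 := ⟨_, rfl⟩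
  obtain ⟨e1, he1⟩ : ∃ e, e = B.coord (Sum.inr (Sum.inl 0)) := ⟨_, rfl⟩
  obtain ⟨e3, he3⟩ : ∃ e, e = B.coord (Sum.inr (Sum.inr ())) := ⟨_, rfl⟩
  have hexp : ∀ v, v = e1 v • y + e3 v • z := by
    intro v
    conv_lhs => rw [← B.sum_repr v]
    rw [Fintype.sum_sum_type, Fintype.sum_sum_type]
    erw [Fin.sum_univ_zero]
    rw [he1, he3, hy, ← hBy 0, ← hBz]
    simp
  have a11 : e1 y = 1 := by simp [he1, hy, ← hBy]
  have a13 : e1 z = 0 := by simp [he1, ← hBz]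
  have b11 : br F L y y = z := by rw [hy, hyy]; simp
  have b13 : br F L y z = 0 := by rw [hy, hyz]
  have b31 : br F L z y = 0 := by rw [hy, hzy]
  have g1 : y ∈ gr F L 1 := hy ▸ hy1 0
  clear hy he1 he3 hyy hyz hzy hy1 hBy hBz B xv yv
  have hy0 : y ≠ 0 := by rintro rfl; simp at a11
  have hev : ∀ v ∈ gr F L 0, e1 v = 0 := by
    intro v hv
    have h1 : e1 v • y ∈ gr F L 0 := by
      have : e1 v • y = v - e3 v • z := eq_sub_of_add_eq (hexp v).symm
      rw [this]
      exact Submodule.sub_mem _ hv (Submodule.smul_mem _ _ hz0)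
    have h2 := (Submodule.disjoint_def.1 (SuperModule.isCompl_grade (F := F) (V := L)).disjoint) _
      h1 (Submodule.smul_mem _ _ g1)
    exact (smul_eq_zero.1 h2).resolve_right hy0
  have hbr : ∀ u v, br F L u v = (e1 u * e1 v) • z := by
    intro u v
    conv_lhs => rw [hexp u, hexp v]
    simp only [map_add, map_smul, LinearMap.add_apply, LinearMap.smul_apply, b11, b13, b31, hzz]
    module
  have hebr : ∀ u v, e1 (br F L u v) = 0 := by intro u v; rw [hbr]; simp [a13]
  have s1 : sgn F 1 1 = -1 := by simp [sgn]
  have s2 : sgn F 1 (1 + 1) = 1 := by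
    have : ¬ ((1 : ZMod 2) + 1 = 1) := by decide
    simp [sgn]
  have h3 : (3 : F) ≠ 0 := by
    intro h
    have h4 : ringChar F ∣ 3 := (ringChar.spec F 3).1 (by exact_mod_cast h)
    rcases (Nat.dvd_prime Nat.prime_three).1 h4 with h5 | h5
    · have h6 : ((1 : ℕ) : F) = 0 := (ringChar.spec F 1).2 (by rw [h5])
      simp at h6
    · exact hchar3 h5
  have r1 := p.rel1 1 1 y y y g1 g1
  have r2 := p.rel2 1 1 1 y y y g1 g1 g1
  rw [b11, s1] at r1
  rw [b11, s1, s2] at r2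
  have pzy : p.pair z y = 0 := by
    have h5 : (3 : F) • p.pair z y = 0 := by
      have h6 : p.pair z y = (4 : F) • p.pair z y := by
        conv_lhs => rw [r1, r2]
        module
      have h7 : (4 : F) • p.pair z y = (3 : F) • p.pair z y + p.pair z y := by module
      rw [h7] at h6
      exact right_eq_add.1 h6
    exact (smul_eq_zero.1 h5).resolve_left h3
  have pyz : p.pair y z = 0 := by rw [r2, pzy]; simp
  have pzz : p.pair z z = 0 := by
    have := p.rel1 1 1 y y z g1 g1
    rw [b11, b13] at this
    simpa using this
  let q : L →ₗ[F] L →ₗ[F] (Fin 1 → F) := LinearMap.mk₂ F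
    (fun x y => fun _ => e1 x * e1 y)
    (by intros; ext i; simp; ring)
    (by intros; ext i; simp; ring)
    (by intros; ext i; simp; ring)
    (by intros; ext i; simp; ring)
  have hq : ∀ x y, q x y = fun _ => e1 x * e1 y := fun x y => rfl
  have hz2 : ∀ a : ZMod 2, a = 0 ∨ a = 1 := by decide
  refine key_lemma F L T p hT 1 q ?_ ?_ ?_ ?_ (fun i => p.pair y y) (fun _ => y) (fun _ => y)
    (fun i => rfl) ?_ ?_ ?_ ?_
  · intro a b x y hx hy hab
    rw [hq]
    rcases hz2 a with rfl | rfl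
    · rw [hev x hx]; ext; simp
    · rcases hz2 b with rfl | rfl
      · rw [hev y hy]; ext; simp
      · exact absurd (by decide) hab
  · intro a b x x' y hx hx'
    simp only [hq, hebr]
    ext; simp
  · intro a b c x y y' hx hy hy'
    simp only [hq, hebr]
    ext; simp
  · intro x y x' y'
    simp only [hq, hebr]
    ext; simp
  · intro i
    ext j
    rw [Subsingleton.elim j i, hq]
    simp [a11]
  · intro i
    exact p.pair_grade 1 1 _ _ g1 g1
  · intro i j
    rw [p.rel3 1 1 y y y y g1 g1, b11, pzz, smul_zero]
  · intro u v
    rw [Fin.sum_univ_one, hq]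
    conv_lhs => rw [hexp u, hexp v]
    simp only [map_add, map_smul, LinearMap.add_apply, LinearMap.smul_apply, pzy, pyz, pzz]
    module

theorem stmt_3 (F : Type*) [Field F] (hchar2 : ringChar F ≠ 2) (hchar3 : ringChar F ≠ 3)
    (L1 : Type*) [AddCommGroup L1] [Module F L1] [SuperModule F L1] [LieSuperAlgebra F L1] (h1 : IsHmn F 1 0 L1)
    (T1 : Type*) [AddCommGroup T1] [Module F T1] [SuperModule F T1] [LieSuperAlgebra F T1]
    (p1 : TensorSqPairing F L1 T1) (hT1 : IsTensorSquare F L1 T1 p1)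
    (L0 : Type*) [AddCommGroup L0] [Module F L0] [SuperModule F L0] [LieSuperAlgebra F L0] (h0 : IsHmn F 0 1 L0)
    (T0 : Type*) [AddCommGroup T0] [Module F T0] [SuperModule F T0] [LieSuperAlgebra F T0]
    (p0 : TensorSqPairing F L0 T0) (hT0 : IsTensorSquare F L0 T0 p0) :
    IsAbelianOfDim F 6 0 T1 ∧ IsAbelianOfDim F 1 0 T0 := by
  exact ⟨heis_one F L1 h1 T1 p1 hT1, heis_zero F hchar3 L0 h0 T0 p0 hT0⟩
end

section
/- For m ≥ 2, the non-abelian tensor square of the Heisenberg Lie superalgebra H_m with odd center satisfies H_m ⊗ H_m ≅ (H_m/H_m²) ⊗ (H_m/H_m²). Moreover, H₁ ⊗ H₁ ≅ A(2 | 3). -/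
open Module Function TensorProduct

universe u v w x y z

section Helpers

lemma z2_cases (a : ZMod 2) : a = 0 ∨ a = 1 := by decide +revert

lemma z2_ne {a b : ZMod 2} (h : a ≠ b) : a = b + 1 := by decide +revert

lemma gr_split {F : Type u} {V : Type v} [Field F] [AddCommGroup V] [Module F V]
    [SuperModule F V] (a : ZMod 2) (x : V) :
    ∃ x' ∈ gr F V a, ∃ x'' ∈ gr F V (a + 1), x = x' + x'' := by
  have h : x ∈ gr F V 0 ⊔ gr F V 1 := by
    rw [(SuperModule.isCompl_grade (F := F) (V := V)).sup_eq_top]; trivial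
  obtain ⟨y, hy, z, hz, rfl⟩ := Submodule.mem_sup.1 h
  rcases z2_cases a with rfl | rfl
  · exact ⟨y, hy, z, by simpa using hz, rfl⟩
  · exact ⟨z, hz, y, by simpa [show (1 : ZMod 2) + 1 = 0 from rfl] using hy, add_comm _ _⟩

lemma gr_disj {F : Type u} {V : Type v} [Field F] [AddCommGroup V] [Module F V]
    [SuperModule F V] (a : ZMod 2) (x : V) (h : x ∈ gr F V a) (h' : x ∈ gr F V (a + 1)) :
    x = 0 := by
  have key := (SuperModule.isCompl_grade (F := F) (V := V)).disjoint
  rw [Submodule.disjoint_def] at key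
  rcases z2_cases a with rfl | rfl
  · exact key x h (by simpa using h')
  · exact key x (by simpa [show (1 : ZMod 2) + 1 = 0 from rfl] using h') h

lemma gr_lift {F : Type u} {V : Type v} {W : Type w} [Field F] [AddCommGroup V] [Module F V]
    [SuperModule F V] [AddCommGroup W] [Module F W] [SuperModule F W] (f : V →ₗ[F] W)
    (hf : ∀ (a : ZMod 2) (x : V), x ∈ gr F V a → f x ∈ gr F W a)
    (hs : Function.Surjective f) (a : ZMod 2) (y : W) (hy : y ∈ gr F W a) :
    ∃ x ∈ gr F V a, f x = y := by
  obtain ⟨x, rfl⟩ := hs y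
  obtain ⟨x', hx', x'', hx'', rfl⟩ := gr_split (F := F) a x
  refine ⟨x', hx', ?_⟩
  have : f x'' = 0 := by
    apply gr_disj (F := F) a _ _ (hf _ _ hx'')
    have := (gr F W a).sub_mem hy (hf _ _ hx')
    simpa using this
  simp [this]

lemma gr_coord {F : Type u} {V : Type v} [Field F] [AddCommGroup V] [Module F V]
    [SuperModule F V] {ι : Type w} [Fintype ι] (B : Basis ι F V) (deg : ι → ZMod 2)
    (hB : ∀ i, B i ∈ gr F V (deg i)) (a : ZMod 2) (x : V) (hx : x ∈ gr F V a) (i : ι)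
    (hi : deg i ≠ a) : B.repr x i = 0 := by
  classical
  have h1 := B.sum_repr x
  rw [← Finset.sum_filter_add_sum_filter_not Finset.univ (fun i => deg i = a)] at h1
  have h2 : ∑ i ∈ Finset.univ.filter (fun i => deg i = a), B.repr x i • B i ∈ gr F V a := by
    refine Submodule.sum_mem _ fun j hj => Submodule.smul_mem _ _ ?_
    have := hB j
    rwa [(Finset.mem_filter.1 hj).2] at this
  have h3 : ∑ i ∈ Finset.univ.filter (fun i => ¬ deg i = a), B.repr x i • B i
      ∈ gr F V (a + 1) := by
    refine Submodule.sum_mem _ fun j hj => Submodule.smul_mem _ _ ?_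
    have := hB j
    rwa [z2_ne (Finset.mem_filter.1 hj).2] at this
  have h4 : ∑ i ∈ Finset.univ.filter (fun i => ¬ deg i = a), B.repr x i • B i = 0 := by
    apply gr_disj (F := F) a _ _ h3
    rw [← eq_sub_iff_add_eq'] at h1
    rw [h1]
    exact Submodule.sub_mem _ hx h2
  exact linearIndependent_iff'.1 B.linearIndependent _ _ h4 i (by simp [hi])

/-- Lifting a supermodule to a higher universe. -/
instance instSuperModuleULift {F : Type u} {V : Type v} [Field F] [AddCommGroup V] [Module F V]
    [SuperModule F V] : SuperModule F (ULift.{w} V) where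
  grade a := (gr F V a).comap (ULift.moduleEquiv (R := F) (M := V)).toLinearMap
  isCompl_grade := by
    constructor
    · rw [Submodule.disjoint_def]
      rintro ⟨x⟩ h h'
      have := gr_disj (F := F) 0 x h (by simpa using h')
      rw [this]; rfl
    · rw [codisjoint_iff, eq_top_iff]
      rintro ⟨x⟩ -
      obtain ⟨x', hx', x'', hx'', rfl⟩ := gr_split (F := F) 0 x
      exact Submodule.mem_sup.2 ⟨⟨x'⟩, hx', ⟨x''⟩, by simpa using hx'', rfl⟩

lemma mem_gr_ulift {F : Type u} {V : Type v} [Field F] [AddCommGroup V] [Module F V]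
    [SuperModule F V] (a : ZMod 2) (x : ULift.{w} V) :
    x ∈ gr F (ULift.{w} V) a ↔ x.down ∈ gr F V a := Iff.rfl

/-- Lifting a Lie superalgebra to a higher universe. -/
instance instLSAULift {F : Type u} {V : Type v} [Field F] [AddCommGroup V] [Module F V]
    [SuperModule F V] [LieSuperAlgebra F V] : LieSuperAlgebra F (ULift.{w} V) where
  bracket := LinearMap.mk₂ F (fun x y => ⟨br F V x.down y.down⟩)
    (by intros; apply ULift.down_injective; simp) (by intros; apply ULift.down_injective; simp)
    (by intros; apply ULift.down_injective; simp) (by intros; apply ULift.down_injective; simp)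
  bracket_grade a b x y hx hy := LieSuperAlgebra.bracket_grade a b x.down y.down hx hy
  skew a b x y hx hy := ULift.down_injective (LieSuperAlgebra.skew a b x.down y.down hx hy)
  jacobi a b c x y z hx hy hz :=
    ULift.down_injective (LieSuperAlgebra.jacobi a b c x.down y.down z.down hx hy hz)

lemma down_br_ulift {F : Type u} {V : Type v} [Field F] [AddCommGroup V] [Module F V]
    [SuperModule F V] [LieSuperAlgebra F V] (x y : ULift.{w} V) :
    (br F (ULift.{w} V) x y).down = br F V x.down y.down := rfl

/-- Model abelian Lie superalgebra with a homogeneous basis of given degrees. -/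
def Mdl (F : Type u) (ι : Type v) (_deg : ι → ZMod 2) : Type (max u v) := ι → F

instance (F : Type u) [Field F] (ι : Type v) (deg : ι → ZMod 2) : AddCommGroup (Mdl F ι deg) :=
  inferInstanceAs (AddCommGroup (ι → F))

instance (F : Type u) [Field F] (ι : Type v) (deg : ι → ZMod 2) : Module F (Mdl F ι deg) :=
  inferInstanceAs (Module F (ι → F))

/-- Graded pieces of the model. -/
def mdlGrade (F : Type u) [Field F] (ι : Type v) (deg : ι → ZMod 2) (a : ZMod 2) :
    Submodule F (Mdl F ι deg) where
  carrier := {c | ∀ i, deg i ≠ a → c i = 0}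
  add_mem' := by
    intro c d hc hd i hi
    show c i + d i = 0
    rw [hc i hi, hd i hi, add_zero]
  zero_mem' := fun i _ => rfl
  smul_mem' := by
    intro r c hc i hi
    show r * c i = 0
    rw [hc i hi, mul_zero]

instance instSuperModuleMdl (F : Type u) [Field F] (ι : Type v) (deg : ι → ZMod 2) :
    SuperModule F (Mdl F ι deg) where
  grade := mdlGrade F ι deg
  isCompl_grade := by
    constructor
    · rw [Submodule.disjoint_def]
      intro c h h'
      funext i
      rcases z2_cases (deg i) with hi | hi
      · exact h' i (by simp [hi])
      · exact h i (by simp [hi])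
    · rw [codisjoint_iff, eq_top_iff]
      intro c _
      refine Submodule.mem_sup.2 ⟨fun i => if deg i = 0 then c i else 0, ?_,
        fun i => if deg i = 0 then 0 else c i, ?_, ?_⟩
      · intro i hi; simp [hi]
      · intro i hi
        have : deg i = 0 := by rcases z2_cases (deg i) with h | h <;> simp_all
        simp [this]
      · funext i
        show (if deg i = 0 then c i else 0) + (if deg i = 0 then 0 else c i) = c i
        split_ifs <;> simp

instance instLSAMdl (F : Type u) [Field F] (ι : Type v) (deg : ι → ZMod 2) :
    LieSuperAlgebra F (Mdl F ι deg) where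
  bracket := 0
  bracket_grade a b x y _ _ := by simp
  skew a b x y _ _ := by simp
  jacobi a b c x y z _ _ _ := by simp

lemma br_mdl (F : Type u) [Field F] (ι : Type v) (deg : ι → ZMod 2) (c d : Mdl F ι deg) :
    br F (Mdl F ι deg) c d = 0 := rfl

lemma LieSuperHom.ext_lin {F : Type u} {L : Type v} {M : Type w} [Field F]
    [AddCommGroup L] [Module F L] [SuperModule F L] [LieSuperAlgebra F L]
    [AddCommGroup M] [Module F M] [SuperModule F M] [LieSuperAlgebra F M]
    {f g : LieSuperHom F L M} (h : f = g) (x : L) : f.toLinearMap x = g.toLinearMap x := by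
  rw [h]

/-- Lifting a pairing. -/
def TensorSqPairing.ulift {F : Type u} {L : Type v} {T : Type w} [Field F]
    [AddCommGroup L] [Module F L] [SuperModule F L] [LieSuperAlgebra F L]
    [AddCommGroup T] [Module F T] [SuperModule F T] [LieSuperAlgebra F T]
    (p : TensorSqPairing F L T) : TensorSqPairing F L (ULift.{x} T) where
  pair := p.pair.compr₂ (ULift.moduleEquiv (R := F) (M := T)).symm.toLinearMap
  pair_grade a b u v hu hv := p.pair_grade a b u v hu hv
  rel1 a b u v t hu hv := ULift.down_injective (p.rel1 a b u v t hu hv)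
  rel2 a b c u v t hu hv ht := ULift.down_injective (p.rel2 a b c u v t hu hv ht)
  rel3 a b u v t s hu hv := ULift.down_injective (p.rel3 a b u v t s hu hv)

/-- Key criterion. -/
lemma iso_model {F : Type u} {L : Type v} {T : Type w} [Field F]
    [AddCommGroup L] [Module F L] [SuperModule F L] [LieSuperAlgebra F L]
    [AddCommGroup T] [Module F T] [SuperModule F T] [LieSuperAlgebra F T]
    (p : TensorSqPairing F L T) (hT : IsTensorSquare F L T p)
    {ι : Type} [Fintype ι] [DecidableEq ι] (deg : ι → ZMod 2)
    (k : TensorSqPairing F L (Mdl F ι deg)) (s t : ι → L)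
    (hk : ∀ i, k.pair (s i) (t i) = (Pi.single i 1 : ι → F))
    (hdeg : ∀ i, p.pair (s i) (t i) ∈ gr F T (deg i))
    (hp : ∀ a b, p.pair a b = ∑ i, (k.pair a b : ι → F) i • p.pair (s i) (t i))
    (hbr : ∀ i j, br F T (p.pair (s i) (t i)) (p.pair (s j) (t j)) = 0) :
    LSAIsomorphic F T (Mdl F ι deg) := by
  obtain ⟨h, hh, -⟩ := hT (ULift.{max v w} (Mdl F ι deg)) k.ulift
  let g : Mdl F ι deg →ₗ[F] T := Fintype.linearCombination F (fun i => p.pair (s i) (t i))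
  have hg : ∀ c, g c = ∑ i, (c : ι → F) i • p.pair (s i) (t i) := fun c => rfl
  let h0 : T →ₗ[F] Mdl F ι deg :=
    (ULift.moduleEquiv (R := F) (M := Mdl F ι deg)).toLinearMap ∘ₗ h.toLinearMap
  have hh0 : ∀ a b, h0 (p.pair a b) = k.pair a b := fun a b =>
    congrArg ULift.down (hh a b)
  have hgg : ∀ (a : ZMod 2) (c : Mdl F ι deg), c ∈ gr F _ a → g c ∈ gr F T a := by
    intro a c hc
    rw [hg]
    refine Submodule.sum_mem _ fun i _ => ?_
    by_cases hi : deg i = a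
    · exact Submodule.smul_mem _ _ (hi ▸ hdeg i)
    · rw [hc i hi, zero_smul]; exact Submodule.zero_mem _
  have hh0g : ∀ (a : ZMod 2) (c : T), c ∈ gr F _ a → h0 c ∈ gr F (Mdl F ι deg) a := fun a c hc =>
    h.map_grade a c hc
  have hh0b : ∀ a b, h0 (br F T a b) = 0 := fun a b => congrArg ULift.down (h.map_bracket a b)
  have hgbr : ∀ c d, br F T (g c) (g d) = 0 := by
    intro c d
    simp [hg, hbr]
  let e : LieSuperHom F T (ULift.{max u v} T) :=
    { toLinearMap := (ULift.moduleEquiv (R := F) (M := T)).symm.toLinearMap ∘ₗ g ∘ₗ h0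
      map_grade := fun a c hc => hgg a _ (hh0g a c hc)
      map_bracket := fun a b => ULift.down_injective (by
        show g (h0 (br F T a b)) = br F T (g (h0 a)) (g (h0 b))
        rw [hh0b, hgbr, map_zero]) }
  let e' : LieSuperHom F T (ULift.{max u v} T) :=
    { toLinearMap := (ULift.moduleEquiv (R := F) (M := T)).symm.toLinearMap
      map_grade := fun a c hc => hc
      map_bracket := fun a b => rfl }
  have hee : e = e' := by
    refine (hT (ULift.{max u v} T) p.ulift).unique ?_ ?_
    · intro a b
      apply ULift.down_injective
      show g (h0 (p.pair a b)) = p.pair a b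
      rw [hh0, hg, ← hp]
    · intro a b; rfl
  have hgh : ∀ a, g (h0 a) = a := fun a =>
    congrArg ULift.down (LieSuperHom.ext_lin hee a)
  refine ⟨⟨h0, hh0g, fun a b => hh0b a b⟩, ?_, ?_⟩
  · exact Function.LeftInverse.injective hgh
  · intro c
    refine ⟨g c, ?_⟩
    show h0 (g c) = c
    rw [hg, map_sum]
    simp only [map_smul, hh0, hk]
    exact (pi_eq_sum_univ' (c : ι → F)).symm.trans (by rfl) |>.symm ▸ rfl

@[simp] lemma mdl_add_apply (F : Type u) [Field F] (ι : Type v) (deg : ι → ZMod 2)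
    (c d : Mdl F ι deg) (i : ι) : (c + d) i = c i + d i := rfl

@[simp] lemma mdl_sub_apply (F : Type u) [Field F] (ι : Type v) (deg : ι → ZMod 2)
    (c d : Mdl F ι deg) (i : ι) : (c - d) i = c i - d i := rfl

@[simp] lemma mdl_smul_apply (F : Type u) [Field F] (ι : Type v) (deg : ι → ZMod 2)
    (r : F) (d : Mdl F ι deg) (i : ι) : (r • d) i = r * d i := rfl

@[simp] lemma mdl_zero_apply (F : Type u) [Field F] (ι : Type v) (deg : ι → ZMod 2)
    (i : ι) : (0 : Mdl F ι deg) i = 0 := rfl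

/-- A function, viewed as an element of the model. -/
def toMdl {F : Type u} {ι : Type v} {deg : ι → ZMod 2} (c : ι → F) : Mdl F ι deg := c

@[simp] lemma toMdl_apply {F : Type u} {ι : Type v} {deg : ι → ZMod 2} (c : ι → F) (i : ι) :
    (toMdl c : Mdl F ι deg) i = c i := rfl

lemma iso_trans_symm {F : Type u} {A : Type v} {B : Type w} {C : Type x} [Field F]
    [AddCommGroup A] [Module F A] [SuperModule F A] [LieSuperAlgebra F A]
    [AddCommGroup B] [Module F B] [SuperModule F B] [LieSuperAlgebra F B]
    [AddCommGroup C] [Module F C] [SuperModule F C] [LieSuperAlgebra F C]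
    (h1 : LSAIsomorphic F A C) (h2 : LSAIsomorphic F B C) : LSAIsomorphic F A B := by
  obtain ⟨f, hf⟩ := h1
  obtain ⟨g, hg⟩ := h2
  let e := LinearEquiv.ofBijective g.toLinearMap hg
  have he : ∀ b, g.toLinearMap (e.symm b) = b := fun b => e.apply_symm_apply b
  refine ⟨⟨e.symm.toLinearMap ∘ₗ f.toLinearMap, ?_, ?_⟩, ?_⟩
  · intro a x hx
    obtain ⟨b, hb, hb'⟩ := gr_lift g.toLinearMap g.map_grade hg.2 a _ (f.map_grade a x hx)
    have : e.symm (f.toLinearMap x) = b := by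
      rw [← hb']; exact e.symm_apply_apply b
    show e.symm (f.toLinearMap x) ∈ _
    rwa [this]
  · intro x y
    apply hg.1
    show g.toLinearMap (e.symm (f.toLinearMap (br F A x y))) =
      g.toLinearMap (br F B (e.symm (f.toLinearMap x)) (e.symm (f.toLinearMap y)))
    rw [he, g.map_bracket, he, he, f.map_bracket]
  · exact e.symm.bijective.comp hf

lemma finrank_gr_mdl (F : Type u) [Field F] (ι : Type) [Fintype ι] (deg : ι → ZMod 2)
    (a : ZMod 2) : finrank F (gr F (Mdl F ι deg) a) = Fintype.card {i // deg i = a} := by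
  let r : gr F (Mdl F ι deg) a →ₗ[F] ({i // deg i = a} → F) :=
    { toFun := fun c i => (c.1 : ι → F) i.1
      map_add' := fun c d => rfl
      map_smul' := fun c d => rfl }
  have hr : Function.Bijective r := by
    constructor
    · rintro ⟨c, hc⟩ ⟨d, hd⟩ h
      apply Subtype.ext
      funext i
      by_cases hi : deg i = a
      · exact congrFun h ⟨i, hi⟩
      · exact (hc i hi).trans (hd i hi).symm
    · intro c
      refine ⟨⟨fun i => if hi : deg i = a then c ⟨i, hi⟩ else 0, ?_⟩, ?_⟩
      · intro i hi; simp [hi]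
      · funext i
        show (if hi : deg i = a then c ⟨i, hi⟩ else 0) = c i
        simp [i.2]
  rw [(LinearEquiv.ofBijective r hr).finrank_eq, Module.finrank_fintype_fun_eq_card]

lemma finrank_gr_iso {F : Type u} {A : Type v} {C : Type x} [Field F]
    [AddCommGroup A] [Module F A] [SuperModule F A] [LieSuperAlgebra F A]
    [AddCommGroup C] [Module F C] [SuperModule F C] [LieSuperAlgebra F C]
    (h1 : LSAIsomorphic F A C) (a : ZMod 2) :
    finrank F (gr F A a) = finrank F (gr F C a) := by
  obtain ⟨f, hf⟩ := h1
  let r : gr F A a →ₗ[F] gr F C a := f.toLinearMap.restrict (f.map_grade a)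
  have hr : Function.Bijective r := by
    constructor
    · intro c d h
      exact Subtype.ext (hf.1 (congrArg Subtype.val h))
    · rintro ⟨c, hc⟩
      obtain ⟨b, hb, hb'⟩ := gr_lift f.toLinearMap f.map_grade hf.2 a _ hc
      exact ⟨⟨b, hb⟩, Subtype.ext hb'⟩
  exact (LinearEquiv.ofBijective r hr).finrank_eq

/-- The rank-one criterion: pairing factors through coordinates `π`. -/
lemma iso_coord {F : Type u} {L : Type v} {T : Type w} [Field F]
    [AddCommGroup L] [Module F L] [SuperModule F L] [LieSuperAlgebra F L]
    [AddCommGroup T] [Module F T] [SuperModule F T] [LieSuperAlgebra F T]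
    (p : TensorSqPairing F L T) (hT : IsTensorSquare F L T p)
    {ι : Type} [Fintype ι] [DecidableEq ι] (deg : ι → ZMod 2)
    (π : L →ₗ[F] (ι → F)) (s : ι → L)
    (hπs : ∀ i, π (s i) = Pi.single i 1) (hs : ∀ i, s i ∈ gr F L (deg i))
    (hπ : ∀ a x, x ∈ gr F L a → ∀ i, deg i ≠ a → π x i = 0)
    (hπb : ∀ x y, π (br F L x y) = 0)
    (hp1 : ∀ x y, p.pair x y = p.pair (∑ i, π x i • s i) y)
    (hp2 : ∀ x y, p.pair x y = p.pair x (∑ i, π y i • s i)) :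
    LSAIsomorphic F T (Mdl F (ι × ι) (fun q => deg q.1 + deg q.2)) := by
  have hz : ∀ x y z, p.pair (br F L x y) z = 0 := by
    intro x y z
    rw [hp1, hπb]; simp
  let kk : L →ₗ[F] L →ₗ[F] Mdl F (ι × ι) (fun q => deg q.1 + deg q.2) :=
    LinearMap.mk₂ F (fun x y => toMdl (fun q => π x q.1 * π y q.2))
      (by intro x x' y; funext q; simp [add_mul])
      (by intro c x y; funext q; simp [mul_assoc])
      (by intro x x' y; funext q; simp [mul_add])
      (by intro c x y; funext q; simp [mul_left_comm])
  have hkk : ∀ x y q, (kk x y : ι × ι → F) q = π x q.1 * π y q.2 := fun x y q => rfl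
  have hk1 : ∀ x y z, kk (br F L x y) z = 0 := by
    intro x y z; funext q; rw [hkk, hπb]; simp
  have hk2 : ∀ x y z, kk x (br F L y z) = 0 := by
    intro x y z; funext q; rw [hkk, hπb]; simp
  let k : TensorSqPairing F L (Mdl F (ι × ι) (fun q => deg q.1 + deg q.2)) :=
    { pair := kk
      pair_grade := by
        intro a b x y hx hy q hq
        rw [hkk]
        by_cases h1 : deg q.1 = a
        · have h2 : deg q.2 ≠ b := by
            rintro rfl; exact hq (by simp [h1])
          rw [hπ b y hy _ h2, mul_zero]
        · rw [hπ a x hx _ h1, zero_mul]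
      rel1 := by intro a b x x' y _ _; simp [hk1, hk2]
      rel2 := by intro a b c x x' y _ _ _; simp [hk1, hk2]
      rel3 := by intro a b x x' y y' _ _; rw [hk1, smul_zero, br_mdl] }
  refine iso_model p hT _ k (fun q => s q.1) (fun q => s q.2) ?_ ?_ ?_ ?_
  · rintro ⟨i, j⟩
    funext ⟨i', j'⟩
    show π (s i) i' * π (s j) j' = _
    rw [hπs, hπs]
    by_cases h1 : i' = i <;> by_cases h2 : j' = j <;> simp [h1, h2]
  · rintro ⟨i, j⟩
    exact p.pair_grade _ _ _ _ (hs i) (hs j)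
  · intro x y
    rw [hp1, hp2, Fintype.sum_prod_type]
    show _ = ∑ i, ∑ j, (π x i * π y j) • p.pair (s i) (s j)
    simp [mul_smul, Finset.smul_sum]
    rw [Finset.sum_comm]
    refine Finset.sum_congr rfl fun i _ => Finset.sum_congr rfl fun j _ => ?_
    first | rfl | rw [smul_comm]
  · rintro ⟨i, j⟩ ⟨i', j'⟩
    rw [p.rel3 _ _ _ _ _ _ (hs i) (hs j), hz, smul_zero]

/-- Embedding of indices. -/
def embI (m : ℕ) : Fin m ⊕ Fin m → Fin m ⊕ Fin m ⊕ Unit :=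
  Sum.elim Sum.inl (fun j => Sum.inr (Sum.inl j))

/-- Degrees of the non-central basis. -/
def degI (m : ℕ) : Fin m ⊕ Fin m → ZMod 2 := Sum.elim (fun _ => 0) (fun _ => 1)

lemma part_one {F : Type u} [Field F] (m : ℕ) (hm : 2 ≤ m)
    {L : Type v} [AddCommGroup L] [Module F L] [SuperModule F L] [LieSuperAlgebra F L]
    (hL : IsHmOdd F m L)
    {T : Type w} [AddCommGroup T] [Module F T] [SuperModule F T] [LieSuperAlgebra F T]
    (p : TensorSqPairing F L T) (hT : IsTensorSquare F L T p)
    {Q : Type x} [AddCommGroup Q] [Module F Q] [SuperModule F Q] [LieSuperAlgebra F Q]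
    (hQ : IsQuotientByDerived F L Q)
    {TQ : Type y} [AddCommGroup TQ] [Module F TQ] [SuperModule F TQ] [LieSuperAlgebra F TQ]
    (pQ : TensorSqPairing F Q TQ) (hTQ : IsTensorSquare F Q TQ pQ) :
    LSAIsomorphic F T TQ := by
  obtain ⟨xv, yv, zv, B, hBx, hBy, hBz, hx, hy, hz, hxx, hxy, hyx, hyy, hxz, hzx, hyz, hzy,
    hzz⟩ := hL
  obtain ⟨f, hf, hker⟩ := hQ
  haveI : Nontrivial (Fin m) := Fin.nontrivial_iff_two_le.2 hm
  let deg3 : Fin m ⊕ Fin m ⊕ Unit → ZMod 2 := Sum.elim (fun _ => 0) (fun _ => 1)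
  have hB3 : ∀ i, B i ∈ gr F L (deg3 i) := by
    rintro (i | i | i)
    · rw [hBx]; exact hx i
    · rw [hBy]; exact hy i
    · rw [hBz]; exact hz
  have hde : ∀ i, deg3 (embI m i) = degI m i := by rintro (i | i) <;> rfl
  let s : Fin m ⊕ Fin m → L := fun i => B (embI m i)
  let π : L →ₗ[F] (Fin m ⊕ Fin m → F) := LinearMap.pi fun i => B.coord (embI m i)
  have hπa : ∀ x i, π x i = B.repr x (embI m i) := fun x i => rfl
  have hinj : Function.Injective (embI m) := by
    rintro (i | i) (j | j) h <;> simp_all [embI]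
  have hπs : ∀ i, π (s i) = Pi.single i 1 := by
    intro i; funext j
    rw [hπa, Basis.repr_self, Finsupp.single_apply, Pi.single_apply]
    simp only [hinj.eq_iff, eq_comm]
  have hs : ∀ i, s i ∈ gr F L (degI m i) := fun i => hde i ▸ hB3 _
  have hπ : ∀ a x, x ∈ gr F L a → ∀ i, degI m i ≠ a → π x i = 0 := by
    intro a x hx i hi
    exact gr_coord B deg3 hB3 a x hx _ (by rwa [hde])
  have hπz : π zv = 0 := by
    funext i
    rw [hπa, ← hBz, Basis.repr_self]
    rcases i with i | i <;> simp [embI]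
  have hdec : ∀ x, ∃ c : F, x = ∑ i, π x i • s i + c • zv := by
    intro x
    refine ⟨B.repr x (Sum.inr (Sum.inr ())), ?_⟩
    conv_lhs => rw [← B.sum_repr x]
    rw [Fintype.sum_sum_type, Fintype.sum_sum_type, Fintype.sum_sum_type]
    simp [hπa, s, embI, hBz, add_assoc]
  have hπb : ∀ x y, π (br F L x y) = 0 := by
    have : (br F L).compr₂ π = 0 := by
      refine B.ext fun i => B.ext fun j => ?_
      rw [LinearMap.compr₂_apply]
      rcases i with i | i | i <;> rcases j with j | j | j <;>
        simp only [hBx, hBy, hBz, hxx, hxy, hyx, hyy, hxz, hzx, hyz, hzy, hzz] <;>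
        (try split_ifs) <;> simp [hπz]
    intro x y
    have := LinearMap.congr_fun (LinearMap.congr_fun this x) y
    simpa using this
  have i0 : Fin m := ⟨0, by omega⟩
  have hzb : ∀ i, br F L (xv i) (yv i) = zv := fun i => by rw [hxy, if_pos rfl]
  have hpz1 : ∀ a, p.pair zv a = 0 := by
    have : p.pair zv = 0 := by
      refine B.ext fun j => ?_
      have key : ∀ (i : Fin m), p.pair zv (B j) =
          p.pair (xv i) (br F L (yv i) (B j)) - sgn F 0 1 • p.pair (yv i) (br F L (xv i) (B j)) :=
        fun i => by
          have := p.rel1 0 1 (xv i) (yv i) (B j) (hx i) (hy i)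
          rwa [hzb i] at this
      rcases j with j | j | j
      · obtain ⟨i, hi⟩ := exists_ne j
        rw [key i, hBx, hxx, hyx, if_neg hi]; simp
      · obtain ⟨i, hi⟩ := exists_ne j
        rw [key i, hBy, hyy, hxy, if_neg hi]; simp
      · rw [key i0, hBz, hxz, hyz]; simp
    intro a; rw [this]; rfl
  have hpz2 : ∀ a, p.pair a zv = 0 := by
    have : p.pair.flip zv = 0 := by
      refine B.ext fun j => ?_
      rw [LinearMap.flip_apply, ← hzb i0, p.rel2 (deg3 j) 0 1 _ _ _ (hB3 j) (hx i0) (hy i0)]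
      rcases j with j | j | j <;>
        simp only [hBx, hBy, hBz, hxx, hxy, hyx, hyy, hxz, hzx, hyz, hzy, hzz] <;>
        (try split_ifs) <;> simp [hpz1]
    intro a
    simpa using LinearMap.congr_fun this a
  have iso1 := iso_coord p hT (degI m) π s hπs hs hπ hπb
    (by
      intro x y
      obtain ⟨c, hc⟩ := hdec x
      conv_lhs => rw [hc]
      simp [hpz1])
    (by
      intro x y
      obtain ⟨c, hc⟩ := hdec y
      conv_lhs => rw [hc]
      simp [hpz2])
  have hfz : f.toLinearMap zv = 0 := by
    rw [← LinearMap.mem_ker, hker]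
    exact Submodule.subset_span ⟨xv i0, yv i0, hzb i0⟩
  have hfb : ∀ x y, f.toLinearMap (br F L x y) = 0 := by
    intro x y
    rw [← LinearMap.mem_ker, hker]
    exact Submodule.subset_span ⟨x, y, rfl⟩
  have hQb : ∀ x y, br F Q x y = 0 := by
    intro x y
    obtain ⟨x, rfl⟩ := hf x
    obtain ⟨y, rfl⟩ := hf y
    rw [← f.map_bracket, hfb]
  have hkπ : ∀ x, f.toLinearMap x = 0 → π x = 0 := by
    intro x hx
    have h1 : derivedSub F L ≤ LinearMap.ker π := by
      refine Submodule.span_le.2 ?_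
      rintro _ ⟨x, y, rfl⟩
      exact hπb x y
    rw [← LinearMap.mem_ker, hker] at hx
    exact h1 hx
  obtain ⟨r, hr⟩ := f.toLinearMap.exists_rightInverse_of_surjective (LinearMap.range_eq_top.2 hf)
  have hr' : ∀ q, f.toLinearMap (r q) = q := fun q => LinearMap.congr_fun hr q
  have hπr : ∀ x, π (r (f.toLinearMap x)) = π x := by
    intro x
    rw [← sub_eq_zero, ← map_sub]
    apply hkπ
    rw [map_sub, hr', sub_self]
  have hdecQ : ∀ q, q = ∑ i, (π ∘ₗ r) q i • f.toLinearMap (s i) := by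
    intro q
    obtain ⟨x, rfl⟩ := hf q
    rw [LinearMap.comp_apply, hπr]
    obtain ⟨c, hc⟩ := hdec x
    conv_lhs => rw [hc]
    simp [hfz]
  have iso2 := iso_coord pQ hTQ (degI m) (π ∘ₗ r) (fun i => f.toLinearMap (s i))
    (by intro i; rw [LinearMap.comp_apply, hπr, hπs])
    (fun i => f.map_grade _ _ (hs i))
    (by
      intro a q hq i hi
      obtain ⟨x, hx, rfl⟩ := gr_lift f.toLinearMap f.map_grade hf a q hq
      rw [LinearMap.comp_apply, hπr]
      exact hπ a x hx i hi)
    (by intro x y; rw [hQb, map_zero])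
    (by intro x y; rw [← hdecQ x])
    (by intro x y; rw [← hdecQ y])
  exact iso_trans_symm iso1 iso2

set_option maxHeartbeats 4000000 in
lemma part_two {F : Type u} [Field F] (h2 : (2 : F) ≠ 0)
    {L : Type v} [AddCommGroup L] [Module F L] [SuperModule F L] [LieSuperAlgebra F L]
    (hL : IsHmOdd F 1 L)
    {T : Type w} [AddCommGroup T] [Module F T] [SuperModule F T] [LieSuperAlgebra F T]
    (p : TensorSqPairing F L T) (hT : IsTensorSquare F L T p) :
    IsAbelianOfDim F 2 3 T := by
  obtain ⟨xv, yv, zv, B, hBx, hBy, hBz, hx, hy, hz, hxx, hxy, hyx, hyy, hxz, hzx, hyz, hzy,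
    hzz⟩ := hL
  let deg3 : Fin 1 ⊕ Fin 1 ⊕ Unit → ZMod 2 := Sum.elim (fun _ => 0) (fun _ => 1)
  have hB3 : ∀ i, B i ∈ gr F L (deg3 i) := by
    rintro (i | i | i)
    · rw [hBx]; exact hx i
    · rw [hBy]; exact hy i
    · rw [hBz]; exact hz
  obtain ⟨x, hxe⟩ : ∃ x, x = xv 0 := ⟨_, rfl⟩
  obtain ⟨y, hye⟩ : ∃ y, y = yv 0 := ⟨_, rfl⟩
  replace hBx := hBx 0
  replace hBy := hBy 0
  replace hx := hx 0
  replace hy := hy 0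
  replace hxx := hxx 0 0
  replace hxy := hxy 0 0
  replace hyx := hyx 0 0
  replace hyy := hyy 0 0
  replace hxz := hxz 0
  replace hzx := hzx 0
  replace hyz := hyz 0
  replace hzy := hzy 0
  rw [if_pos rfl] at hxy hyx
  rw [← hxe] at hBx hx hxx hxy hyx hxz hzx
  rw [← hye] at hBy hy hyy hxy hyx hyz hzy
  let X : L →ₗ[F] F := B.coord (Sum.inl 0)
  let Y : L →ₗ[F] F := B.coord (Sum.inr (Sum.inl 0))
  let Z : L →ₗ[F] F := B.coord (Sum.inr (Sum.inr ()))
  have hdec : ∀ a, a = X a • x + Y a • y + Z a • zv := by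
    intro a
    conv_lhs => rw [← B.sum_repr a]
    rw [Fintype.sum_sum_type, Fintype.sum_sum_type]
    simp [X, Y, Z, hBx, hBy, hBz, add_assoc]
  have hXx : X x = 1 := by simp [X, ← hBx]
  have hXy : X y = 0 := by simp [X, ← hBy]
  have hXz : X zv = 0 := by simp [X, ← hBz]
  have hYx : Y x = 0 := by simp [Y, ← hBx]
  have hYy : Y y = 1 := by simp [Y, ← hBy]
  have hYz : Y zv = 0 := by simp [Y, ← hBz]
  have hZx : Z x = 0 := by simp [Z, ← hBx]
  have hZy : Z y = 0 := by simp [Z, ← hBy]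
  have hZz : Z zv = 1 := by simp [Z, ← hBz]
  have hX1 : ∀ a, a ∈ gr F L 1 → X a = 0 := fun a ha =>
    gr_coord B deg3 hB3 1 a ha _ (by simp [deg3])
  have hY0 : ∀ a, a ∈ gr F L 0 → Y a = 0 := fun a ha =>
    gr_coord B deg3 hB3 0 a ha _ (by simp [deg3])
  have hZ0 : ∀ a, a ∈ gr F L 0 → Z a = 0 := fun a ha =>
    gr_coord B deg3 hB3 0 a ha _ (by simp [deg3])
  have hbr : ∀ a b, br F L a b = (X a * Y b - Y a * X b) • zv := by
    intro a b
    conv_lhs => rw [hdec a, hdec b]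
    simp only [map_add, map_smul, LinearMap.add_apply, LinearMap.smul_apply, hxx, hxy, hyx, hyy,
      hxz, hzx, hyz, hzy, hzz]
    module
  have hXb : ∀ a b, X (br F L a b) = 0 := by intro a b; rw [hbr]; simp [hXz]
  have hYb : ∀ a b, Y (br F L a b) = 0 := by intro a b; rw [hbr]; simp [hYz]
  have hZb : ∀ a b, Z (br F L a b) = X a * Y b - Y a * X b := by
    intro a b; rw [hbr]; simp [hZz]
  clear_value X Y Z
  have s10 : sgn F 1 0 = 1 := by simp [sgn]
  have s01 : sgn F 0 1 = 1 := by simp [sgn]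
  have s00 : sgn F 0 0 = 1 := by simp [sgn]
  have s11 : sgn F 1 1 = -1 := by simp [sgn]
  have e11 : (1 : ZMod 2) + 1 = 0 := rfl
  -- values of the pairing on the centre
  have pzz : p.pair zv zv = 0 := by
    have := p.rel1 0 1 x y zv hx hy
    rw [hxy, hyz, hxz] at this
    simpa using this
  have pzx : p.pair zv x = - p.pair x zv := by
    have := p.rel1 0 1 x y x hx hy
    rw [hxy, hyx, hxx] at this
    simpa using this
  have pyz : p.pair y zv = 0 := by
    have := p.rel1 1 1 y y x hy hy
    rw [hyy, hyx, s11] at this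
    have h : (2 : F) • p.pair y zv = 0 := by
      rw [two_smul]
      simp only [map_zero, LinearMap.zero_apply, map_neg, neg_smul, one_smul] at this
      have h' := this.symm
      rw [sub_neg_eq_add, ← neg_add, neg_eq_zero] at h'
      exact h'
    exact (smul_eq_zero.1 h).resolve_left h2
  have pzy : p.pair zv y = 0 := by
    have := p.rel1 0 1 x y y hx hy
    rw [hxy, hyy, pyz] at this
    simpa using this
  let deg : Fin 5 → ZMod 2 := ![0, 0, 1, 1, 1]
  let kk : L →ₗ[F] L →ₗ[F] Mdl F (Fin 5) deg :=
    LinearMap.mk₂ F (fun a b => toMdl (![X a * X b, Y a * Y b, X a * Y b, Y a * X b,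
        X a * Z b - Z a * X b] : Fin 5 → F))
      (by intro a a' b; funext q; fin_cases q <;> simp <;> ring)
      (by intro c a b; funext q; fin_cases q <;> simp <;> ring)
      (by intro a b b'; funext q; fin_cases q <;> simp <;> ring)
      (by intro c a b; funext q; fin_cases q <;> simp <;> ring)
  have hkk : ∀ a b, kk a b = toMdl (![X a * X b, Y a * Y b, X a * Y b, Y a * X b,
        X a * Z b - Z a * X b] : Fin 5 → F) := fun a b => rfl
  let k : TensorSqPairing F L (Mdl F (Fin 5) deg) :=
    { pair := kk
      pair_grade := by
        intro a b u v hu hv q hq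
        rw [hkk]
        rcases z2_cases a with rfl | rfl <;> rcases z2_cases b with rfl | rfl <;>
          fin_cases q <;> simp [deg, e11] at hq <;>
          simp [hX1, hY0, hZ0, hu, hv]
      rel1 := by
        intro a b u u' v hu hu'
        funext q
        simp only [mdl_sub_apply, mdl_smul_apply, hkk, hXb, hYb, hZb]
        rcases z2_cases a with rfl | rfl <;> rcases z2_cases b with rfl | rfl <;>
          simp only [s00, s01, s10, s11] <;>
          fin_cases q <;> simp [hX1, hY0, hZ0, hu, hu'] <;> ring
      rel2 := by
        intro a b c u v v' hu hv hv'
        funext q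
        simp only [mdl_sub_apply, mdl_smul_apply, hkk, hXb, hYb, hZb]
        rcases z2_cases a with rfl | rfl <;> rcases z2_cases b with rfl | rfl <;>
          rcases z2_cases c with rfl | rfl <;>
          simp only [s00, s01, s10, s11, e11, add_zero, zero_add] <;>
          fin_cases q <;> simp [hX1, hY0, hZ0, hu, hv, hv'] <;> ring
      rel3 := by
        intro a b u v u' v' _ _
        funext q
        rw [br_mdl]
        simp only [mdl_smul_apply, mdl_zero_apply, hkk, hXb, hYb, hZb]
        fin_cases q <;> simp }
  have iso := iso_model p hT deg k ![x, y, x, y, x] ![x, y, y, x, zv]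
    (by
      intro i
      show kk _ _ = _
      rw [hkk]
      fin_cases i <;> funext q <;> fin_cases q <;>
        simp [hXx, hXy, hXz, hYx, hYy, hYz, hZx, hZy, hZz])
    (by
      intro i
      fin_cases i
      · simpa [deg] using p.pair_grade 0 0 x x hx hx
      · simpa [deg, e11] using p.pair_grade 1 1 y y hy hy
      · simpa [deg] using p.pair_grade 0 1 x y hx hy
      · simpa [deg] using p.pair_grade 1 0 y x hy hx
      · simpa [deg] using p.pair_grade 0 1 x zv hx hz)
    (by
      intro a b
      show _ = ∑ i, (kk a b : Fin 5 → F) i • _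
      rw [hkk]
      conv_lhs => rw [hdec a, hdec b]
      simp only [map_add, map_smul, LinearMap.add_apply, LinearMap.smul_apply, pzz, pzx, pzy, pyz]
      simp [Fin.sum_univ_succ]
      module)
    (by
      have key : ∀ a b : L, ∀ α β : ZMod 2, a ∈ gr F L α → b ∈ gr F L β → ∀ a' b',
          br F T (p.pair a b) (p.pair a' b') = 0 := by
        intro a b α β ha hb a' b'
        rw [p.rel3 α β _ _ _ _ ha hb, hbr, hbr]
        simp [pzz]
      intro i j
      fin_cases i
      · exact key _ _ 0 0 hx hx _ _
      · exact key _ _ 1 1 hy hy _ _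
      · exact key _ _ 0 1 hx hy _ _
      · exact key _ _ 1 0 hy hx _ _
      · exact key _ _ 0 1 hx hz _ _)
  refine ⟨?_, ?_, ?_⟩
  · obtain ⟨f, hf⟩ := iso
    intro a b
    apply hf.1
    rw [f.map_bracket, br_mdl, map_zero]
  · rw [finrank_gr_iso iso, finrank_gr_mdl]; decide
  · rw [finrank_gr_iso iso, finrank_gr_mdl]; decide

end Helpers

theorem stmt_4 (F : Type*) [Field F] (hchar2 : ringChar F ≠ 2) (hchar3 : ringChar F ≠ 3)
    (m : ℕ) (hm : 1 ≤ m)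
    (L : Type*) [AddCommGroup L] [Module F L] [SuperModule F L] [LieSuperAlgebra F L] (hL : IsHmOdd F m L)
    (T : Type*) [AddCommGroup T] [Module F T] [SuperModule F T] [LieSuperAlgebra F T]
    (p : TensorSqPairing F L T) (hT : IsTensorSquare F L T p)
    (Q : Type*) [AddCommGroup Q] [Module F Q] [SuperModule F Q] [LieSuperAlgebra F Q] (hQ : IsQuotientByDerived F L Q)
    (TQ : Type*) [AddCommGroup TQ] [Module F TQ] [SuperModule F TQ] [LieSuperAlgebra F TQ]
    (pQ : TensorSqPairing F Q TQ) (hTQ : IsTensorSquare F Q TQ pQ) :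
    (2 ≤ m → LSAIsomorphic F T TQ) ∧ (m = 1 → IsAbelianOfDim F 2 3 T) := by
  refine ⟨fun h => part_one m h hL p hT hQ pQ hTQ, ?_⟩
  rintro rfl
  exact part_two (Ring.two_ne_zero hchar2) hL p hT
end

section
/- Let M be a finite-dimensional Lie superalgebra over a field of characteristic ≠ 2, 3 and let M² = [M, M] be its derived subalgebra. Then Γ(M/M²) ≅ (M/M²) □ (M/M²). -/
open Module Function TensorProduct

universe u v w x y z

theorem aux_proj (F : Type*) [Field F] (Q : Type*) [AddCommGroup Q] [Module F Q]
    [SuperModule F Q] :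
    ∃ P : Q →ₗ[F] Q, (∀ x ∈ gr F Q 0, P x = 0) ∧ (∀ x ∈ gr F Q 1, P x = x) ∧
      ∀ x, P (P x) = P x := by
  have hc := SuperModule.isCompl_grade (F := F) (V := Q)
  have hP0 : ∀ x ∈ gr F Q 0, Submodule.projection _ _ hc.symm x = 0 := fun x hx => by
    rw [Submodule.projection_apply_eq_zero_iff]; exact hx
  have hP1 : ∀ x ∈ gr F Q 1, Submodule.projection _ _ hc.symm x = x := fun x hx => by
    rw [Submodule.projection_eq_self_iff]; exact hx
  refine ⟨Submodule.projection _ _ hc.symm, hP0, hP1, fun x => hP1 _ ?_⟩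
  exact Submodule.projection_apply_mem _ x

/-- grading from an involution -/
def invSuper (F : Type*) [Field F] (h2 : (2 : F) ≠ 0) (W : Type*) [AddCommGroup W] [Module F W]
    (s : W →ₗ[F] W) (hs : ∀ x, s (s x) = x) : SuperModule F W where
  grade a := if a = 0 then LinearMap.ker (s - LinearMap.id) else LinearMap.ker (s + LinearMap.id)
  isCompl_grade := by
    simp only [if_true, one_ne_zero, if_false]
    constructor
    · rw [Submodule.disjoint_def]
      intro x hx hx'
      simp only [LinearMap.mem_ker, LinearMap.sub_apply, LinearMap.add_apply, LinearMap.id_apply]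
        at hx hx'
      have h : (2 : F) • x = 0 := by
        rw [two_smul]
        have := sub_eq_zero.1 hx
        rw [this] at hx'; exact hx'
      exact (smul_eq_zero.1 h).resolve_left h2
    · rw [codisjoint_iff, eq_top_iff]
      intro x _
      rw [Submodule.mem_sup]
      refine ⟨(2:F)⁻¹ • (x + s x), ?_, (2:F)⁻¹ • (x - s x), ?_, ?_⟩
      · simp only [LinearMap.mem_ker, LinearMap.sub_apply, LinearMap.id_apply, map_smul, map_add, hs]
        module
      · simp only [LinearMap.mem_ker, LinearMap.add_apply, LinearMap.id_apply, map_smul, map_sub, hs]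
        module
      · rw [← smul_add, add_add_sub_cancel, ← two_smul F x, smul_smul, inv_mul_cancel₀ h2, one_smul]

/-- zero bracket -/
def zeroLSA (F : Type*) [Field F] (W : Type*) [AddCommGroup W] [Module F W]
    [SuperModule F W] : LieSuperAlgebra F W where
  bracket := 0
  bracket_grade := by intros; simp
  skew := by intros; simp
  jacobi := by intros; simp

theorem aux_lift {F : Type u} [Field F] (h2 : (2 : F) ≠ 0)
    {Q : Type v} [AddCommGroup Q] [Module F Q] [SuperModule F Q] [LieSuperAlgebra F Q]
    (hab : ∀ x y : Q, br F Q x y = 0)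
    {TQ : Type w} [AddCommGroup TQ] [Module F TQ] [SuperModule F TQ] [LieSuperAlgebra F TQ]
    (pQ : TensorSqPairing F Q TQ) (hTQ : IsTensorSquare F Q TQ pQ) :
    ∃ h : TQ →ₗ[F] (Q ⊗[F] Q), ∀ x y, h (pQ.pair x y) = x ⊗ₜ y := by
  obtain ⟨P, hP0, hP1, hPP⟩ := aux_proj F Q
  let σ : Q →ₗ[F] Q := LinearMap.id - (2 : F) • P
  have hσ : ∀ x, σ (σ x) = x := by
    intro x
    simp only [σ, LinearMap.sub_apply, LinearMap.smul_apply, LinearMap.id_apply, map_sub, map_smul,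
      hPP]
    module
  let W := ULift.{max u v w} (Q ⊗[F] Q)
  let E : W ≃ₗ[F] (Q ⊗[F] Q) := ULift.moduleEquiv
  let s : W →ₗ[F] W := E.symm.toLinearMap ∘ₗ (TensorProduct.map σ σ) ∘ₗ E.toLinearMap
  have hss : ∀ x, s (s x) = x := by
    intro x
    have : TensorProduct.map σ σ ∘ₗ TensorProduct.map σ σ = LinearMap.id := by
      ext a b; simp [hσ]
    have h' := LinearMap.congr_fun this (E x)
    simp only [LinearMap.comp_apply, LinearMap.id_apply] at h'
    simp [s, h']
  letI : SuperModule F W := invSuper F h2 W s hss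
  letI : LieSuperAlgebra F W := zeroLSA F W
  have hbr : ∀ x y : W, br F W x y = 0 := fun x y => rfl
  have hσ0 : ∀ x ∈ gr F Q 0, σ x = x := fun x hx => by simp [σ, hP0 x hx]
  have hσ1 : ∀ x ∈ gr F Q 1, σ x = -x := fun x hx => by
    simp only [σ, LinearMap.sub_apply, LinearMap.smul_apply, LinearMap.id_apply, hP1 x hx]
    module
  have hg0 : ∀ x : W, s x = x → x ∈ gr F W 0 := fun x hx => by
    show x ∈ (if (0 : ZMod 2) = 0 then LinearMap.ker (s - LinearMap.id) else _)
    rw [if_pos rfl, LinearMap.mem_ker, LinearMap.sub_apply, hx, LinearMap.id_apply, sub_self]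
  have hg1 : ∀ x : W, s x = -x → x ∈ gr F W 1 := fun x hx => by
    show x ∈ (if (1 : ZMod 2) = 0 then _ else LinearMap.ker (s + LinearMap.id))
    rw [if_neg one_ne_zero, LinearMap.mem_ker, LinearMap.add_apply, hx, LinearMap.id_apply]
    simp
  have hsT : ∀ x y, s (E.symm (x ⊗ₜ y)) = E.symm (σ x ⊗ₜ σ y) := by
    intro x y; simp [s]
  let q : TensorSqPairing F Q W :=
    { pair := (TensorProduct.mk F Q Q).compr₂ E.symm.toLinearMap
      pair_grade := by
        intro a b x y hx hy
        show E.symm (x ⊗ₜ y) ∈ _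
        have h01 : ∀ c : ZMod 2, c = 0 ∨ c = 1 := by decide
        rcases h01 a with rfl | rfl <;> rcases h01 b with rfl | rfl
        · exact hg0 _ (by rw [hsT, hσ0 x hx, hσ0 y hy])
        · exact hg1 _ (by rw [hsT, hσ0 x hx, hσ1 y hy, TensorProduct.tmul_neg, map_neg])
        · exact hg1 _ (by rw [hsT, hσ1 x hx, hσ0 y hy, TensorProduct.neg_tmul, map_neg])
        · exact hg0 _ (by rw [hsT, hσ1 x hx, hσ1 y hy, TensorProduct.tmul_neg,
            TensorProduct.neg_tmul, neg_neg])
      rel1 := by intros; simp only [hab, map_zero, LinearMap.zero_apply, smul_zero, sub_zero]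
      rel2 := by intros; simp only [hab, map_zero, LinearMap.zero_apply, smul_zero, sub_zero]
      rel3 := by
        intros; simp only [hab, hbr, map_zero, LinearMap.zero_apply, smul_zero] }
  obtain ⟨h, hh, -⟩ := hTQ W q
  refine ⟨E.toLinearMap ∘ₗ h.toLinearMap, fun x y => ?_⟩
  rw [LinearMap.comp_apply, hh]
  simp [q]

theorem aux_gamma {F : Type u} [Field F] (h2 : (2 : F) ≠ 0)
    {Q : Type v} [AddCommGroup Q] [Module F Q] [SuperModule F Q]
    {G : Type w} [AddCommGroup G] [Module F G]
    (d : GammaData F Q G) (hG : IsGamma F Q G d) :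
    ∃ g : G →ₗ[F] (Q ⊗[F] Q), Function.Injective g ∧
      (∀ q ∈ gr F Q 0, g (d.gam q) = q ⊗ₜ q) ∧
      (∀ (a b : ZMod 2) (q q' : Q), q ∈ gr F Q a → q' ∈ gr F Q b →
        g (d.bil q q') = q ⊗ₜ q' + sgn F a b • (q' ⊗ₜ q)) ∧
      (∀ N : Submodule F G, (∀ q ∈ gr F Q 0, d.gam q ∈ N) → (∀ q q', d.bil q q' ∈ N) →
        N = ⊤) := by
  obtain ⟨P, hP0, hP1, hPP⟩ := aux_proj F Q
  have h01 : ∀ c : ZMod 2, c = 0 ∨ c = 1 := by decide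
  let W := ULift.{max u v w} (Q ⊗[F] Q)
  let E : W ≃ₗ[F] (Q ⊗[F] Q) := ULift.moduleEquiv
  let T : Q →ₗ[F] Q →ₗ[F] W := (TensorProduct.mk F Q Q).compr₂ E.symm.toLinearMap
  let B : Q →ₗ[F] Q →ₗ[F] W := T + T.flip - (2 : F) • T.flip.compl₁₂ P P
  have hBdef : ∀ x y, B x y = T x y + T y x - (2 : F) • T (P y) (P x) := fun x y => rfl
  have hB : ∀ (a b : ZMod 2) (x y : Q), x ∈ gr F Q a → y ∈ gr F Q b →
      B x y = T x y + sgn F a b • T y x := by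
    intro a b x y hx hy
    rw [hBdef]
    rcases h01 a with rfl | rfl <;> rcases h01 b with rfl | rfl
    · simp [hP0 x hx, sgn]
    · simp [hP0 x hx, sgn]
    · simp [hP0 y hy, sgn]
    · simp only [hP1 x hx, hP1 y hy, sgn, and_self, if_true]; module
  let d' : GammaData F Q W :=
    { gam := fun v => T v v
      bil := B
      gam_smul := by intro c v _; simp [smul_smul]
      gam_add := by
        intro v w hv hw
        rw [hB 0 0 v w hv hw]
        simp [sgn]; abel
      bil_symm := by
        intro a b v w hv hw
        rw [hB a b v w hv hw, hB b a w v hw hv]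
        rcases h01 a with rfl | rfl <;> rcases h01 b with rfl | rfl <;> simp [sgn] <;> abel
      bil_alt := by
        intro v hv
        rw [hB 1 1 v v hv hv]; simp [sgn] }
  obtain ⟨g, ⟨hg1, hg2⟩, -⟩ := hG W d'
  let EG : ULift.{max u v w} G ≃ₗ[F] G := ULift.moduleEquiv
  -- uniqueness
  have huniq : ∀ f : G →ₗ[F] G, (∀ q ∈ gr F Q 0, f (d.gam q) = d.gam q) →
      (∀ q q', f (d.bil q q') = d.bil q q') → f = LinearMap.id := by
    intro f hf1 hf2
    let dG : GammaData F Q (ULift.{max u v w} G) :=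
      { gam := fun v => EG.symm (d.gam v)
        bil := d.bil.compr₂ EG.symm.toLinearMap
        gam_smul := by intro c v hv; rw [d.gam_smul c v hv, map_smul]
        gam_add := by
          intro v w hv hw
          rw [← map_sub, ← map_sub, d.gam_add v w hv hw]; rfl
        bil_symm := by
          intro a b v w hv hw
          simp only [LinearMap.compr₂_apply]
          rw [d.bil_symm a b v w hv hw, map_smul]
        bil_alt := by
          intro v hv
          simp only [LinearMap.compr₂_apply]
          rw [d.bil_alt v hv, map_zero] }
    have := (hG _ dG).unique (y₁ := EG.symm.toLinearMap ∘ₗ f) (y₂ := EG.symm.toLinearMap)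
      ⟨fun v hv => by simp [dG, hf1 v hv], fun v w => by simp [dG, hf2 v w]⟩
      ⟨fun v hv => by simp [dG], fun v w => by simp [dG]⟩
    ext x
    have h' := LinearMap.congr_fun this x
    exact EG.symm.injective h'
  -- decomposition
  have hdec : ∀ x : Q, ∃ y ∈ gr F Q 0, ∃ z ∈ gr F Q 1, y + z = x := fun x => by
    have hc := SuperModule.isCompl_grade (F := F) (V := Q)
    exact Submodule.mem_sup.1 (hc.sup_eq_top ▸ Submodule.mem_top)
  have hgE : ∀ (a b : ZMod 2) (q q' : Q), q ∈ gr F Q a → q' ∈ gr F Q b →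
        E (g (d.bil q q')) = q ⊗ₜ q' + sgn F a b • (q' ⊗ₜ q) := by
    intro a b q q' hq hq'
    rw [hg2]
    show E (B q q') = _
    rw [hB a b q q' hq hq']
    simp [T]
  have hgam : ∀ q ∈ gr F Q 0, d.bil q q = (2 : F) • d.gam q := by
    intro q hq
    rw [← d.gam_add q q hq hq, ← two_smul F q, d.gam_smul 2 q hq]
    module
  let ψ : (Q ⊗[F] Q) →ₗ[F] G := (2 : F)⁻¹ • TensorProduct.lift d.bil
  have hψ : ∀ x y, ψ (x ⊗ₜ y) = (2 : F)⁻¹ • d.bil x y := fun x y => rfl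
  have hgg : ∀ q ∈ gr F Q 0, E (g (d.gam q)) = q ⊗ₜ q := by
    intro q hq; rw [hg1 q hq]; simp [d', T]
  have hhom : ∀ (a b : ZMod 2) (q q' : Q), q ∈ gr F Q a → q' ∈ gr F Q b →
      ψ (E (g (d.bil q q'))) = d.bil q q' := by
    intro a b q q' hq hq'
    rw [hgE a b q q' hq hq', map_add, map_smul, hψ, hψ, smul_comm, ← smul_add,
      ← d.bil_symm a b q q' hq hq', ← two_smul F (d.bil q q'), smul_smul, inv_mul_cancel₀ h2,
      one_smul]
  have hid : ψ ∘ₗ E.toLinearMap ∘ₗ g = LinearMap.id := by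
    apply huniq
    · intro q hq
      show ψ (E (g (d.gam q))) = _
      rw [hgg q hq, hψ, hgam q hq, smul_smul, inv_mul_cancel₀ h2, one_smul]
    · intro x y
      show ψ (E (g (d.bil x y))) = _
      obtain ⟨x0, hx0, x1, hx1, rfl⟩ := hdec x
      obtain ⟨y0, hy0, y1, hy1, rfl⟩ := hdec y
      simp only [map_add, LinearMap.add_apply]
      rw [hhom 0 0 _ _ hx0 hy0, hhom 0 1 _ _ hx0 hy1, hhom 1 0 _ _ hx1 hy0, hhom 1 1 _ _ hx1 hy1]
  refine ⟨E.toLinearMap ∘ₗ g, ?_, hgg, hgE, ?_⟩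
  · intro x y hxy
    have := congrArg ψ hxy
    have hx := LinearMap.congr_fun hid x
    have hy := LinearMap.congr_fun hid y
    exact hx.symm.trans (this.trans hy)
  · intro N hN1 hN2
    obtain ⟨C, hC⟩ := N.exists_isCompl
    have : Submodule.projection _ _ hC = LinearMap.id := by
      apply huniq
      · intro q hq; rw [Submodule.projection_eq_self_iff]; exact hN1 q hq
      · intro q q'; rw [Submodule.projection_eq_self_iff]; exact hN2 q q'
    rw [eq_top_iff]
    intro x _
    rw [← Submodule.projection_eq_self_iff hC, this]; rfl

theorem stmt_6 (F : Type*) [Field F] (hchar2 : ringChar F ≠ 2) (hchar3 : ringChar F ≠ 3)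
    (M : Type*) [AddCommGroup M] [Module F M] [SuperModule F M] [LieSuperAlgebra F M] [FiniteDimensional F M]
    (Q : Type*) [AddCommGroup Q] [Module F Q] [SuperModule F Q] [LieSuperAlgebra F Q]
    (π : LieSuperHom F M Q) (hπs : Function.Surjective π.toLinearMap)
    (hπk : LinearMap.ker π.toLinearMap = derivedSub F M)
    (TQ : Type*) [AddCommGroup TQ] [Module F TQ] [SuperModule F TQ] [LieSuperAlgebra F TQ]
    (pQ : TensorSqPairing F Q TQ) (hTQ : IsTensorSquare F Q TQ pQ)
    (G : Type*) [AddCommGroup G] [Module F G]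
    (d : GammaData F Q G) (hG : IsGamma F Q G d) :
    ∃ e : G ≃ₗ[F] squareBox F Q TQ pQ,
      (∀ q ∈ gr F Q 0, (e (d.gam q) : TQ) = pQ.pair q q) ∧
      (∀ (a b : ZMod 2) (q q' : Q), q ∈ gr F Q a → q' ∈ gr F Q b →
        (e (d.bil q q') : TQ) = pQ.pair q q' + sgn F a b • pQ.pair q' q) := by
  have h2 : (2 : F) ≠ 0 := Ring.two_ne_zero hchar2
  have hab : ∀ x y : Q, br F Q x y = 0 := by
    intro x y
    obtain ⟨x, rfl⟩ := hπs x
    obtain ⟨y, rfl⟩ := hπs y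
    rw [← π.map_bracket, ← LinearMap.mem_ker, hπk]
    exact Submodule.subset_span ⟨x, y, rfl⟩
  obtain ⟨h, hh⟩ := aux_lift h2 hab pQ hTQ
  obtain ⟨g, hginj, hg1, hg2, hspan⟩ := aux_gamma h2 d hG
  have hlinj : Function.Injective (TensorProduct.lift pQ.pair) := by
    have : h ∘ₗ TensorProduct.lift pQ.pair = LinearMap.id := by
      ext x y; simp [hh]
    exact Function.LeftInverse.injective (g := h) (fun x => LinearMap.congr_fun this x)
  have h01 : ∀ c : ZMod 2, c = 0 ∨ c = 1 := by decide
  let φ : G →ₗ[F] TQ := TensorProduct.lift pQ.pair ∘ₗ g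
  have hφ1 : ∀ q ∈ gr F Q 0, φ (d.gam q) = pQ.pair q q := by
    intro q hq; simp [φ, hg1 q hq]
  have hφ2 : ∀ (a b : ZMod 2) (q q' : Q), q ∈ gr F Q a → q' ∈ gr F Q b →
        φ (d.bil q q') = pQ.pair q q' + sgn F a b • pQ.pair q' q := by
    intro a b q q' hq hq'; simp [φ, hg2 a b q q' hq hq']
  have hdec : ∀ x : Q, ∃ y ∈ gr F Q 0, ∃ z ∈ gr F Q 1, y + z = x := fun x => by
    have hc := SuperModule.isCompl_grade (F := F) (V := Q)
    exact Submodule.mem_sup.1 (hc.sup_eq_top ▸ Submodule.mem_top)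
  have hrange : LinearMap.range φ = squareBox F Q TQ pQ := by
    apply le_antisymm
    · have hmem : ∀ (a b : ZMod 2) (q q' : Q), q ∈ gr F Q a → q' ∈ gr F Q b →
          φ (d.bil q q') ∈ squareBox F Q TQ pQ := fun a b q q' hq hq' =>
        Submodule.subset_span (Or.inl ⟨a, b, q, q', hq, hq', hφ2 a b q q' hq hq'⟩)
      rw [LinearMap.range_le_iff_comap]
      apply hspan
      · intro q hq
        exact Submodule.subset_span (Or.inr ⟨q, hq, hφ1 q hq⟩)
      · intro x y
        obtain ⟨x0, hx0, x1, hx1, rfl⟩ := hdec x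
        obtain ⟨y0, hy0, y1, hy1, rfl⟩ := hdec y
        rw [Submodule.mem_comap]
        simp only [map_add, LinearMap.add_apply]
        exact add_mem (add_mem (hmem 0 0 _ _ hx0 hy0) (hmem 1 0 _ _ hx1 hy0))
          (add_mem (hmem 0 1 _ _ hx0 hy1) (hmem 1 1 _ _ hx1 hy1))
    · apply Submodule.span_le.2
      rintro t (⟨a, b, x, y, hx, hy, rfl⟩ | ⟨x, hx, rfl⟩)
      · exact ⟨_, hφ2 a b x y hx hy⟩
      · exact ⟨_, hφ1 x hx⟩
  have hφinj : Function.Injective φ := hlinj.comp hginj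
  refine ⟨(LinearEquiv.ofInjective φ hφinj).trans (LinearEquiv.ofEq _ _ hrange), ?_, ?_⟩
  · intro q hq; exact hφ1 q hq
  · intro a b q q' hq hq'; exact hφ2 a b q q' hq hq'
end
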